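/- Law of large numbers for the first-derivative quadratic form: Fix (H,σ) ∈ (0,1)×(0,∞) and any sequence Δ_n > 0. Under P^n_{(H,σ)}, D_n → j_H = −(1/(2π)) ∫_{−π}^{π} ∂_H log f_H(λ) dλ in probability as n → ∞. -/

import Mathlib

open MeasureTheory Filter Topology Matrix

noncomputable section

/-- Covariance matrix `T_n(H)` of a standard fractional Gaussian noise: its `(i,j)` entry is
`(|i-j+1|^{2H} - 2|i-j|^{2H} + |i-j-1|^{2H})/2`. -/
def fgnT (n : ℕ) (H : ℝ) : Matrix (Fin n) (Fin n) ℝ := fun i j =>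
  (|((i : ℕ) : ℝ) - ((j : ℕ) : ℝ) + 1| ^ (2 * H)
      - 2 * |((i : ℕ) : ℝ) - ((j : ℕ) : ℝ)| ^ (2 * H)
      + |((i : ℕ) : ℝ) - ((j : ℕ) : ℝ) - 1| ^ (2 * H)) / 2

/-- Quadratic form `⟨x, M x⟩`. -/
def qForm {n : ℕ} (M : Matrix (Fin n) (Fin n) ℝ) (x : Fin n → ℝ) : ℝ :=
  ∑ i, ∑ j, x i * M i j * x j

/-- Centered Gaussian measure on `ℝⁿ` with nondegenerate covariance matrix `S`, given by its
density with respect to Lebesgue measure. -/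
def gaussianPi (n : ℕ) (S : Matrix (Fin n) (Fin n) ℝ) : Measure (Fin n → ℝ) :=
  volume.withDensity fun x => ENNReal.ofReal
    ((2 * Real.pi) ^ (-(n : ℝ) / 2) * S.det ^ (-(1 : ℝ) / 2) *
      Real.exp (-(qForm S⁻¹ x) / 2))

/-- The law `Pⁿ_{(H,σ)}` of fractional Gaussian noise observed with time step `Δ`:
a centered Gaussian measure on `ℝⁿ` with covariance `σ² Δ^{2H} T_n(H)`. -/
def fgnP (n : ℕ) (Δ H σ : ℝ) : Measure (Fin n → ℝ) :=
  gaussianPi n ((σ ^ 2 * Δ ^ (2 * H)) • fgnT n H)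

/-- Spectral density `f_H` of the increments of fractional Brownian motion. -/
def fgnSpec (H l : ℝ) : ℝ :=
  (Real.Gamma (2 * H + 1) * Real.sin (Real.pi * H) / (2 * Real.pi)) *
    (2 * (1 - Real.cos l)) * ∑' k : ℤ, |l + 2 * (k : ℝ) * Real.pi| ^ (-2 * H - 1)

/-- `∂_H log f_H(λ)`. -/
def dlogSpec (H l : ℝ) : ℝ := deriv (fun h : ℝ => Real.log (fgnSpec h l)) H

/-- `j_H = -(1/(2π)) ∫_{-π}^{π} ∂_H log f_H(λ) dλ`. -/
def jH (H : ℝ) : ℝ := -(1 / (2 * Real.pi)) * ∫ l in (-Real.pi)..Real.pi, dlogSpec H l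

/-- `e_H = (1/(4π)) ∫_{-π}^{π} |∂_H log f_H(λ)|² dλ`. -/
def eH (H : ℝ) : ℝ := (1 / (4 * Real.pi)) * ∫ l in (-Real.pi)..Real.pi, (dlogSpec H l) ^ 2

/-- The limit covariance matrix `J(H)` of `(A_n, B_n)`. -/
def Jmat (H : ℝ) : Matrix (Fin 2) (Fin 2) ℝ := !![2, jH H; jH H, eH H]

/-- Log-likelihood `ℓ_n(H,σ)` of the fGn sample. -/
def loglik (n : ℕ) (Δ H σ : ℝ) (x : Fin n → ℝ) : ℝ :=
  -(n : ℝ) / 2 * Real.log (2 * Real.pi) - (n : ℝ) * H * Real.log Δ - (n : ℝ) * Real.log σ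
    - Real.log (fgnT n H).det / 2
    - qForm (fgnT n H)⁻¹ x / (2 * σ ^ 2 * Δ ^ (2 * H))

/-- `C_n = (1/(nσ²Δ^{2H})) ⟨x, T_n(H)⁻¹ x⟩`. -/
def Cstat (n : ℕ) (Δ H σ : ℝ) (x : Fin n → ℝ) : ℝ :=
  qForm (fgnT n H)⁻¹ x / ((n : ℝ) * σ ^ 2 * Δ ^ (2 * H))

/-- `A_n = √n (C_n - 1)`. -/
def Astat (n : ℕ) (Δ H σ : ℝ) (x : Fin n → ℝ) : ℝ :=
  Real.sqrt n * (Cstat n Δ H σ x - 1)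

/-- Entrywise derivative in `H` of `T_n(H)⁻¹`. -/
def dInvT (n : ℕ) (H : ℝ) : Matrix (Fin n) (Fin n) ℝ := fun i j =>
  deriv (fun h : ℝ => (fgnT n h)⁻¹ i j) H

/-- Entrywise second derivative in `H` of `T_n(H)⁻¹`. -/
def d2InvT (n : ℕ) (H : ℝ) : Matrix (Fin n) (Fin n) ℝ := fun i j =>
  deriv (fun h : ℝ => deriv (fun h' : ℝ => (fgnT n h')⁻¹ i j) h) H

/-- Entrywise derivative in `H` of `T_n(H)`. -/
def dT (n : ℕ) (H : ℝ) : Matrix (Fin n) (Fin n) ℝ := fun i j =>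
  deriv (fun h : ℝ => fgnT n h i j) H

/-- `B_n = (1/√n) ( (1/2) ∂_H log det T_n(H) + (1/(2σ²Δ^{2H})) ⟨x, ∂_H(T_n(H)⁻¹) x⟩ )`. -/
def Bstat (n : ℕ) (Δ H σ : ℝ) (x : Fin n → ℝ) : ℝ :=
  (1 / Real.sqrt n) *
    (deriv (fun h : ℝ => Real.log (fgnT n h).det) H / 2
      + qForm (dInvT n H) x / (2 * σ ^ 2 * Δ ^ (2 * H)))

/-- `D_n = (1/(nσ²Δ^{2H})) ⟨x, ∂_H(T_n(H)⁻¹) x⟩`. -/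
def Dstat (n : ℕ) (Δ H σ : ℝ) (x : Fin n → ℝ) : ℝ :=
  qForm (dInvT n H) x / ((n : ℝ) * σ ^ 2 * Δ ^ (2 * H))

/-- `E_n = (1/n) ( (1/2) ∂_H² log det T_n(H) + (1/(2σ²Δ^{2H})) ⟨x, ∂_H²(T_n(H)⁻¹) x⟩ )`. -/
def Estat (n : ℕ) (Δ H σ : ℝ) (x : Fin n → ℝ) : ℝ :=
  (1 / (n : ℝ)) *
    (deriv (fun h : ℝ => deriv (fun h' : ℝ => Real.log (fgnT n h').det) h) H / 2
      + qForm (d2InvT n H) x / (2 * σ ^ 2 * Δ ^ (2 * H)))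

/-- Convergence in law (weak convergence of the laws against bounded continuous functions). -/
def TendstoInLaw {E : Type*} [MeasurableSpace E] [TopologicalSpace E]
    (μ : ℕ → Measure E) (ν : Measure E) : Prop :=
  ∀ g : BoundedContinuousFunction E ℝ,
    Tendsto (fun n => ∫ x, g x ∂μ n) atTop (𝓝 (∫ x, g x ∂ν))

/-- Convergence in law to the centered Gaussian distribution on `ℝᵈ` with covariance matrix `S`,
expressed through the Cramér–Wold device: every linear functional converges in law to the
corresponding one-dimensional centered Gaussian law. -/
def TendstoInLawGaussian {d : ℕ} (μ : ℕ → Measure (Fin d → ℝ))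
    (S : Matrix (Fin d) (Fin d) ℝ) : Prop :=
  ∀ t : Fin d → ℝ,
    TendstoInLaw (fun n => (μ n).map fun z => ∑ i, t i * z i)
      (ProbabilityTheory.gaussianReal 0 (qForm S t).toNNReal)

/-- Convergence in probability to a constant, for statistics defined on varying sample spaces. -/
def TendstoInProb {X : ℕ → Type*} [∀ n, MeasurableSpace (X n)]
    (μ : ∀ n, Measure (X n)) (f : ∀ n, X n → ℝ) (c : ℝ) : Prop :=
  ∀ ε > 0, Tendsto (fun n => μ n {x | ε ≤ |f n x - c|}) atTop (𝓝 0)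

/-- The LAN expansion: the likelihood ratio of `P^n_{θ₀ + φ_n u}` with respect to `P^n_{θ₀}`
is `exp(⟨u, ζ_n⟩ - ½⟨I u, u⟩ + r_n(u))` with `ζ_n → N(0, I)` in law and `r_n(u) → 0` in
probability under `P^n_{θ₀}`. -/
def LANExpansion {X : ℕ → Type*} [∀ n, MeasurableSpace (X n)] {d : ℕ}
    (P : (n : ℕ) → (Fin d → ℝ) → Measure (X n)) (θ₀ : Fin d → ℝ)
    (φ : ℕ → Matrix (Fin d) (Fin d) ℝ) (I : Matrix (Fin d) (Fin d) ℝ) : Prop :=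
  ∃ (ζ : (n : ℕ) → X n → Fin d → ℝ) (r : (n : ℕ) → (Fin d → ℝ) → X n → ℝ),
    (∀ n, Measurable (ζ n)) ∧
    TendstoInLawGaussian (fun n => (P n θ₀).map (ζ n)) I ∧
    ∀ u : Fin d → ℝ,
      (∀ᶠ n in atTop,
        P n (θ₀ + (φ n).mulVec u) = (P n θ₀).withDensity fun x =>
          ENNReal.ofReal (Real.exp (∑ i, u i * ζ n x i - qForm I u / 2 + r n u x))) ∧
      TendstoInProb (fun n => P n θ₀) (fun n => r n u) 0

/-- Local Asymptotic Normality at `θ₀` with nondegenerate rate matrices `φ_n`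
and nondegenerate Fisher information matrix `I`. -/
def IsLAN {X : ℕ → Type*} [∀ n, MeasurableSpace (X n)] {d : ℕ}
    (P : (n : ℕ) → (Fin d → ℝ) → Measure (X n)) (θ₀ : Fin d → ℝ)
    (φ : ℕ → Matrix (Fin d) (Fin d) ℝ) (I : Matrix (Fin d) (Fin d) ℝ) : Prop :=
  (∀ᶠ n in atTop, (φ n).det ≠ 0) ∧ I.det ≠ 0 ∧ LANExpansion P θ₀ φ I

open ProbabilityTheory in
/-- The standard Gaussian product measure on `ℝⁿ` has the expected Lebesgue density. -/
lemma pi_gaussianReal_eq_withDensity (n : ℕ) :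
    Measure.pi (fun _ : Fin n => gaussianReal 0 1) = (volume : Measure (Fin n → ℝ)).withDensity
      fun z => ENNReal.ofReal (∏ i, gaussianPDFReal 0 1 (z i)) := by
  refine Measure.pi_eq fun s hs => ?_
  rw [withDensity_apply _ (MeasurableSet.univ_pi hs)]
  have hint : ∀ i, Integrable ((s i).indicator (gaussianPDFReal 0 1)) volume := fun i =>
    (integrable_gaussianPDFReal 0 1).indicator (hs i)
  have hind : ∀ z : Fin n → ℝ, (Set.univ.pi s).indicator
      (fun z => ENNReal.ofReal (∏ i, gaussianPDFReal 0 1 (z i))) z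
      = ENNReal.ofReal (∏ i, (s i).indicator (gaussianPDFReal 0 1) (z i)) := by
    intro z
    by_cases hz : z ∈ Set.univ.pi s
    · rw [Set.indicator_of_mem hz]
      congr 1
      exact Finset.prod_congr rfl fun i _ =>
        (Set.indicator_of_mem (hz i (Set.mem_univ i)) _).symm
    · rw [Set.indicator_of_notMem hz]
      simp only [Set.mem_pi, Set.mem_univ, true_implies, not_forall] at hz
      obtain ⟨i, hi⟩ := hz
      rw [Finset.prod_eq_zero (Finset.mem_univ i) (Set.indicator_of_notMem hi _),
        ENNReal.ofReal_zero]
  have hnn : ∀ i x, 0 ≤ (s i).indicator (gaussianPDFReal 0 1) x := fun i x =>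
    Set.indicator_nonneg (fun x _ => gaussianPDFReal_nonneg 0 1 x) x
  rw [← lintegral_indicator (MeasurableSet.univ_pi hs), lintegral_congr hind,
    ← ofReal_integral_eq_lintegral_ofReal, volume_pi, integral_fintype_prod_eq_prod,
    ENNReal.ofReal_prod_of_nonneg]
  · refine Finset.prod_congr rfl fun i _ => ?_
    rw [integral_indicator (hs i), gaussianReal_apply_eq_integral 0 one_ne_zero]
  · exact fun i _ => integral_nonneg (hnn i)
  · exact Integrable.fintype_prod (f := fun i => (s i).indicator (gaussianPDFReal 0 1)) hint
  · exact ae_of_all _ fun z => Finset.prod_nonneg fun i _ => hnn i _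

lemma qForm_eq_dotProduct {n : ℕ} (M : Matrix (Fin n) (Fin n) ℝ) (x : Fin n → ℝ) :
    qForm M x = x ⬝ᵥ (M *ᵥ x) := by
  simp only [qForm, dotProduct, mulVec, Finset.mul_sum, mul_assoc]

lemma qForm_mulVec {n : ℕ} (M Y : Matrix (Fin n) (Fin n) ℝ) (z : Fin n → ℝ) :
    qForm M (Y *ᵥ z) = qForm (Yᵀ * M * Y) z := by
  rw [qForm_eq_dotProduct, qForm_eq_dotProduct, ← mulVec_mulVec, ← mulVec_mulVec,
    dotProduct_mulVec z, vecMul_transpose]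

lemma qForm_diagonal {n : ℕ} (d z : Fin n → ℝ) :
    qForm (diagonal d) z = ∑ i, d i * z i ^ 2 := by
  rw [qForm_eq_dotProduct, dotProduct]
  refine Finset.sum_congr rfl fun i _ => ?_
  rw [mulVec_diagonal]; ring

open ProbabilityTheory in
/-- If `Bᵀ S B = 1`, then the centered Gaussian law with covariance `S` is the image of the
standard Gaussian law under `S B`. -/
lemma gaussianPi_eq_map {n : ℕ} {S B : Matrix (Fin n) (Fin n) ℝ} (hS : S.PosDef)
    (hB : Bᵀ * S * B = 1) :
    gaussianPi n S =
      (Measure.pi (fun _ : Fin n => gaussianReal 0 1)).map fun z => (S * B) *ᵥ z := by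
  have hST : Sᵀ = S := hS.isHermitian
  have hY : (S * B)ᵀ * S⁻¹ * (S * B) = 1 := by
    rw [transpose_mul, hST, mul_assoc, mul_assoc, ← mul_assoc S⁻¹,
      nonsing_inv_mul S hS.det_pos.ne'.isUnit, one_mul, ← mul_assoc, hB]
  have hdet : B.det ^ 2 * S.det = 1 := by
    have := congrArg det hB
    rw [det_mul, det_mul, det_transpose, det_one] at this
    linarith
  have hdY : (S * B).det ^ 2 = S.det := by
    rw [det_mul, mul_pow]
    calc S.det ^ 2 * B.det ^ 2 = S.det * (B.det ^ 2 * S.det) := by ring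
      _ = S.det := by rw [hdet, mul_one]
  have hne : (S * B).det ≠ 0 := fun h => hS.det_pos.ne' (by rw [← hdY, h]; simp)
  have hmeas : Measurable fun z : Fin n → ℝ => (S * B) *ᵥ z :=
    (Continuous.matrix_mulVec continuous_const continuous_id).measurable
  have hvol : volume = ENNReal.ofReal |(S * B).det| •
      Measure.map (fun z : Fin n → ℝ => (S * B) *ᵥ z) volume := by
    have := Real.map_matrix_volume_pi_eq_smul_volume_pi hne
    have h2 : Measure.map (fun z : Fin n → ℝ => (S * B) *ᵥ z) volume
        = ENNReal.ofReal |(S * B).det⁻¹| • volume := this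
    rw [h2, smul_smul, ← ENNReal.ofReal_mul (abs_nonneg _), ← abs_mul, mul_inv_cancel₀ hne,
      abs_one, ENNReal.ofReal_one, one_smul]
  have hdabs : |(S * B).det| = S.det ^ (1 / 2 : ℝ) := by
    rw [← hdY, ← Real.sqrt_eq_rpow, Real.sqrt_sq_eq_abs]
  ext A hA
  have hdm : Measurable fun x : Fin n → ℝ => ENNReal.ofReal
      ((2 * Real.pi) ^ (-(n : ℝ) / 2) * S.det ^ (-(1 : ℝ) / 2) *
        Real.exp (-(qForm S⁻¹ x) / 2)) := by
    unfold qForm; fun_prop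
  rw [Measure.map_apply hmeas hA, pi_gaussianReal_eq_withDensity, gaussianPi,
    withDensity_apply _ hA, withDensity_apply _ (hmeas hA)]
  conv_lhs => rw [hvol]
  rw [Measure.restrict_smul, lintegral_smul_measure, setLIntegral_map hA hdm hmeas, smul_eq_mul,
    ← lintegral_const_mul' _ _ ENNReal.ofReal_ne_top]
  refine lintegral_congr fun z => ?_
  rw [← ENNReal.ofReal_mul (abs_nonneg _), qForm_mulVec, hY, ← diagonal_one, qForm_diagonal]
  congr 1
  simp only [gaussianPDFReal, Finset.prod_mul_distrib, ← Real.exp_sum, sub_zero, one_mul,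
    NNReal.coe_one, mul_one, Finset.prod_const, Finset.card_univ, Fintype.card_fin]
  rw [hdabs]
  have h1 : S.det ^ (1 / 2 : ℝ) * S.det ^ (-(1 : ℝ) / 2) = 1 := by
    rw [← Real.rpow_add hS.det_pos]; norm_num
  have h2 : (2 * Real.pi) ^ (-(n : ℝ) / 2) = (√(2 * Real.pi))⁻¹ ^ n := by
    rw [Real.sqrt_eq_rpow, ← Real.rpow_neg (by positivity), ← Real.rpow_mul_natCast (by positivity)]
    congr 1; ring
  rw [h2]
  have h3 : -(∑ i, z i ^ 2) / 2 = ∑ i, -z i ^ 2 / 2 := by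
    rw [← Finset.sum_div, Finset.sum_neg_distrib]
  rw [h3]
  linear_combination (√(2 * Real.pi))⁻¹ ^ n * Real.exp (∑ i, -z i ^ 2 / 2) * h1

open ProbabilityTheory in
/-- Chebyshev's inequality for a diagonal quadratic form in independent standard Gaussians. -/
lemma pi_gaussian_quadratic_chebyshev {n : ℕ} (d : Fin n → ℝ) {ε : ℝ} (hε : 0 < ε) :
    Measure.pi (fun _ : Fin n => gaussianReal 0 1)
      {z | ε ≤ |∑ i, d i * z i ^ 2 - ∑ i, d i|} ≤
    ENNReal.ofReal (Var[fun x => x ^ 2; gaussianReal 0 1] * (∑ i, d i ^ 2) / ε ^ 2) := by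
  set P := Measure.pi (fun _ : Fin n => gaussianReal 0 1)
  have hid : MemLp (id : ℝ → ℝ) 4 (gaussianReal 0 1) := memLp_id_gaussianReal' 4 (by simp)
  have hm1 : MemLp (fun x : ℝ => x ^ 2) 2 (gaussianReal 0 1) := by
    have h := hid.norm_rpow_div 2
    have h42 : (4 : ENNReal) / 2 = 2 := by
      rw [show (4 : ENNReal) = 2 * 2 by norm_num]
      exact ENNReal.mul_div_cancel_right (by simp) (by simp)
    rw [h42] at h
    refine h.congr_norm (by fun_prop) (ae_of_all _ fun x => ?_)
    simp
  have hmp : ∀ i, MeasurePreserving (Function.eval i) P (gaussianReal 0 1) :=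
    fun i => measurePreserving_eval _ i
  have hm : ∀ i, MemLp (fun z : Fin n → ℝ => d i * z i ^ 2) 2 P := fun i =>
    ((hm1.comp_measurePreserving (hmp i)).const_mul (d i))
  have hsum : MemLp (fun z : Fin n → ℝ => ∑ i, d i * z i ^ 2) 2 P :=
    memLp_finsetSum _ fun i _ => hm i
  have hE1 : ∫ x, x ^ 2 ∂(gaussianReal 0 1) = 1 := by
    have h := variance_id_gaussianReal (μ := 0) (v := 1)
    rw [variance_eq_sub (memLp_id_gaussianReal' 2 (by simp))] at h
    simpa using h
  have hEi : ∀ i, ∫ z, d i * z i ^ 2 ∂P = d i := by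
    intro i
    rw [integral_const_mul]
    have h : ∫ x, x ^ 2 ∂(P.map (Function.eval i)) = ∫ z, z i ^ 2 ∂P :=
      integral_map (hmp i).measurable.aemeasurable
        (by fun_prop)
    rw [(hmp i).map_eq] at h
    rw [← h, hE1, mul_one]
  have hVi : ∀ i, Var[fun z : Fin n → ℝ => d i * z i ^ 2; P]
      = d i ^ 2 * Var[fun x => x ^ 2; gaussianReal 0 1] := by
    intro i
    rw [variance_const_mul]
    congr 1
    exact (hmp i).variance_fun_comp (f := fun x => x ^ 2) (by fun_prop)
  have hE : ∫ z, ∑ i, d i * z i ^ 2 ∂P = ∑ i, d i := by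
    rw [integral_finsetSum _ fun i _ => (hm i).integrable (by norm_num)]
    exact Finset.sum_congr rfl fun i _ => hEi i
  have hV : Var[fun z : Fin n → ℝ => ∑ i, d i * z i ^ 2; P]
      = Var[fun x => x ^ 2; gaussianReal 0 1] * ∑ i, d i ^ 2 := by
    have h := IndepFun.variance_sum (μ := P) (s := Finset.univ)
      (X := fun i (z : Fin n → ℝ) => d i * z i ^ 2) (fun i _ => hm i) fun i _ j _ hij =>
        (iIndepFun_pi (μ := fun _ : Fin n => gaussianReal 0 1)
          (X := fun i x => d i * x ^ 2) (fun i => by fun_prop)).indepFun hij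
    have h' : (∑ i, fun z : Fin n → ℝ => d i * z i ^ 2) = fun z => ∑ i, d i * z i ^ 2 := by
      ext z; simp
    rw [h'] at h
    rw [h, Finset.mul_sum]
    exact Finset.sum_congr rfl fun i _ => by rw [hVi, mul_comm]
  have := meas_ge_le_variance_div_sq hsum hε
  rwa [hE, hV] at this

/-- Simultaneous diagonalisation of a positive definite and a symmetric matrix. -/
lemma exists_simultaneous_diagonalization {n : ℕ} {T M : Matrix (Fin n) (Fin n) ℝ}
    (hT : T.PosDef) (hM : M.IsHermitian) :
    ∃ (B : Matrix (Fin n) (Fin n) ℝ) (d : Fin n → ℝ), Bᵀ * T * B = 1 ∧ Bᵀ * M * B = diagonal d := by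
  obtain ⟨A, hA⟩ : ∃ A : Matrix (Fin n) (Fin n) ℝ, T = Aᵀ * A := by
    open scoped MatrixOrder in
    obtain ⟨A, hA⟩ := CStarAlgebra.nonneg_iff_eq_star_mul_self.mp hT.posSemidef.nonneg
    exact ⟨A, hA⟩
  have hAd : IsUnit A.det := by
    refine IsUnit.mk0 _ fun h => hT.det_pos.ne' ?_
    rw [hA, det_mul, h, mul_zero]
  have hW : A⁻¹ᵀ * T * A⁻¹ = 1 := by
    rw [hA, ← mul_assoc, ← transpose_mul, mul_nonsing_inv A hAd, transpose_one, one_mul,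
      mul_nonsing_inv A hAd]
  have hN : (A⁻¹ᵀ * M * A⁻¹).IsHermitian := by
    have := isHermitian_conjTranspose_mul_mul A⁻¹ hM
    simpa using this
  have hU := hN.conjStarAlgAut_star_eigenvectorUnitary
  rw [Unitary.conjStarAlgAut_star_apply] at hU
  set U : Matrix (Fin n) (Fin n) ℝ := (hN.eigenvectorUnitary : Matrix (Fin n) (Fin n) ℝ)
  have hUU : star U * U = 1 := Unitary.coe_star_mul_self _
  refine ⟨A⁻¹ * U, hN.eigenvalues, ?_, ?_⟩
  · rw [transpose_mul]
    calc Uᵀ * A⁻¹ᵀ * T * (A⁻¹ * U) = Uᵀ * (A⁻¹ᵀ * T * A⁻¹) * U := by simp only [mul_assoc]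
      _ = 1 := by rw [hW, mul_one]; exact hUU
  · rw [transpose_mul]
    calc Uᵀ * A⁻¹ᵀ * M * (A⁻¹ * U) = Uᵀ * (A⁻¹ᵀ * M * A⁻¹) * U := by simp only [mul_assoc]
      _ = _ := hU

/-- Concentration of `⟨x, T⁻¹ M T⁻¹ x⟩ / (n c)` under the centered Gaussian law with covariance
`c T`, in terms of the generalised eigenvalues `d` of `M` relative to `T`. -/
lemma gaussianPi_qForm_concentration {n : ℕ} {T M B : Matrix (Fin n) (Fin n) ℝ} {d : Fin n → ℝ}
    (hT : T.PosDef) (hB : Bᵀ * T * B = 1) (hd : Bᵀ * M * B = diagonal d) {c : ℝ} (hc : 0 < c)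
    (hn : 0 < n) {ε : ℝ} (hε : 0 < ε) :
    gaussianPi n (c • T) {x | ε ≤ |qForm (T⁻¹ * M * T⁻¹) x / (n * c) - (∑ i, d i) / n|} ≤
      ENNReal.ofReal (ProbabilityTheory.variance (fun x => x ^ 2)
        (ProbabilityTheory.gaussianReal 0 1) * (∑ i, d i ^ 2) / (n * ε) ^ 2) := by
  have hn' : (0 : ℝ) < n := by exact_mod_cast hn
  have hsc : √c ≠ 0 := (Real.sqrt_pos.2 hc).ne'
  have hcc : √c * √c = c := Real.mul_self_sqrt hc.le
  have hTT : Tᵀ = T := hT.isHermitian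
  have hB' : ((√c)⁻¹ • B)ᵀ * (c • T) * ((√c)⁻¹ • B) = 1 := by
    rw [transpose_smul, smul_mul_smul_comm, smul_mul_smul_comm, hB]
    rw [show (√c)⁻¹ * c * (√c)⁻¹ = 1 by field_simp; rw [pow_two, hcc], one_smul]
  have hTi : T⁻¹ * T = 1 := nonsing_inv_mul T hT.det_pos.ne'.isUnit
  have hTi' : T * T⁻¹ = 1 := mul_nonsing_inv T hT.det_pos.ne'.isUnit
  have hY : (c • T) * ((√c)⁻¹ • B) = √c • (T * B) := by
    rw [smul_mul_smul_comm]
    congr 1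
    field_simp; rw [pow_two, hcc]
  have hmeas : Measurable fun z : Fin n → ℝ => (√c • (T * B)) *ᵥ z :=
    (Continuous.matrix_mulVec continuous_const continuous_id).measurable
  have hq : ∀ z, qForm (T⁻¹ * M * T⁻¹) ((√c • (T * B)) *ᵥ z) = c * ∑ i, d i * z i ^ 2 := by
    intro z
    have : (√c • (T * B))ᵀ * (T⁻¹ * M * T⁻¹) * (√c • (T * B)) = c • diagonal d := by
      rw [transpose_smul, transpose_mul, hTT, smul_mul_assoc, smul_mul_assoc, mul_smul_comm,
        smul_smul, hcc, ← hd]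
      congr 1
      calc Bᵀ * T * (T⁻¹ * M * T⁻¹) * (T * B) = Bᵀ * (T * T⁻¹) * M * (T⁻¹ * T) * B := by
            simp only [mul_assoc]
        _ = _ := by rw [hTi, hTi', mul_one, mul_one]
    rw [qForm_mulVec, this, ← qForm_diagonal]
    simp only [qForm, Finset.mul_sum, Matrix.smul_apply, smul_eq_mul]
    exact Finset.sum_congr rfl fun i _ => Finset.sum_congr rfl fun j _ => by ring
  rw [gaussianPi_eq_map (hT.smul hc) hB', hY, Measure.map_apply hmeas]
  · refine le_trans (measure_mono ?_) (pi_gaussian_quadratic_chebyshev d (mul_pos hn' hε))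
    intro z hz
    simp only [Set.mem_preimage, Set.mem_ofPred_eq, hq] at hz ⊢
    rw [show c * ∑ i, d i * z i ^ 2 = (∑ i, d i * z i ^ 2) * c by ring,
      mul_div_mul_right _ _ hc.ne', ← sub_div, abs_div, abs_of_pos hn', le_div_iff₀ hn'] at hz
    linarith
  · refine measurableSet_le measurable_const ?_
    unfold qForm
    fun_prop

/-- Lebesgue measure on `(-π, π]`. -/
abbrev circ : Measure ℝ := volume.restrict (Set.Ioc (-Real.pi) Real.pi)

/-- The (unnormalised) symmetric Toeplitz matrix of cosine coefficients of `a`. -/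
def toep (a : ℝ → ℝ) (n : ℕ) : Matrix (Fin n) (Fin n) ℝ := fun i j =>
  ∫ l, a l * Real.cos ((((i : ℕ) : ℝ) - ((j : ℕ) : ℝ)) * l) ∂circ

/-- The squared modulus of the trigonometric polynomial with coefficients `x`. -/
def trigSq {n : ℕ} (x : Fin n → ℝ) (l : ℝ) : ℝ :=
  (∑ i, x i * Real.cos ((i : ℕ) * l)) ^ 2 + (∑ i, x i * Real.sin ((i : ℕ) * l)) ^ 2

/-- The Hilbert–Schmidt pairing of two Toeplitz matrices. -/
def toepPair (a b : ℝ → ℝ) (n : ℕ) : ℝ := ∑ i, ∑ j, toep a n i j * toep b n i j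

lemma trigSq_nonneg {n : ℕ} (x : Fin n → ℝ) (l : ℝ) : 0 ≤ trigSq x l := by
  unfold trigSq; positivity

lemma trig_cross {n : ℕ} (x y : Fin n → ℝ) (l : ℝ) :
    (∑ i, x i * Real.cos ((i : ℕ) * l)) * (∑ i, y i * Real.cos ((i : ℕ) * l)) +
      (∑ i, x i * Real.sin ((i : ℕ) * l)) * (∑ i, y i * Real.sin ((i : ℕ) * l)) =
    ∑ i, ∑ j, (x i * y j) * Real.cos ((((i : ℕ) : ℝ) - ((j : ℕ) : ℝ)) * l) := by
  rw [Finset.sum_mul_sum, Finset.sum_mul_sum, ← Finset.sum_add_distrib]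
  refine Finset.sum_congr rfl fun i _ => ?_
  rw [← Finset.sum_add_distrib]
  refine Finset.sum_congr rfl fun j _ => ?_
  rw [sub_mul, Real.cos_sub]; ring

lemma trigSq_eq_sum {n : ℕ} (x : Fin n → ℝ) (l : ℝ) :
    trigSq x l = ∑ i, ∑ j, (x i * x j) * Real.cos ((((i : ℕ) : ℝ) - ((j : ℕ) : ℝ)) * l) := by
  rw [← trig_cross, trigSq]; ring

lemma integrable_mul_cos {a : ℝ → ℝ} (ha : Integrable a circ) (m : ℝ) :
    Integrable (fun l => a l * Real.cos (m * l)) circ :=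
  ha.mul_bdd (c := 1) (by fun_prop) (ae_of_all _ fun l => by
    simpa using Real.abs_cos_le_one _)

lemma sum_mul_toep {n : ℕ} {a : ℝ → ℝ} (ha : Integrable a circ) (M : Fin n → Fin n → ℝ) :
    ∑ i, ∑ j, M i j * toep a n i j =
      ∫ l, a l * ∑ i, ∑ j, M i j * Real.cos ((((i : ℕ) : ℝ) - ((j : ℕ) : ℝ)) * l) ∂circ := by
  simp only [Finset.mul_sum, mul_left_comm (a _)]
  rw [integral_finsetSum _ fun i _ => integrable_finsetSum _ fun j _ =>
    (integrable_mul_cos ha _).const_mul _]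
  refine Finset.sum_congr rfl fun i _ => ?_
  rw [integral_finsetSum _ fun j _ => (integrable_mul_cos ha _).const_mul _]
  refine Finset.sum_congr rfl fun j _ => ?_
  rw [integral_const_mul, toep]

lemma integrable_mul_trigSq {n : ℕ} {a : ℝ → ℝ} (ha : Integrable a circ) (x : Fin n → ℝ) :
    Integrable (fun l => a l * trigSq x l) circ := by
  simp only [trigSq_eq_sum, Finset.mul_sum, mul_left_comm (a _)]
  exact integrable_finsetSum _ fun i _ => integrable_finsetSum _ fun j _ =>
    (integrable_mul_cos ha _).const_mul _

lemma qForm_toep {n : ℕ} {a : ℝ → ℝ} (ha : Integrable a circ) (x : Fin n → ℝ) :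
    qForm (toep a n) x = ∫ l, a l * trigSq x l ∂circ := by
  simp only [trigSq_eq_sum]
  rw [← sum_mul_toep ha, qForm]
  exact Finset.sum_congr rfl fun i _ => Finset.sum_congr rfl fun j _ => by ring

lemma toep_isHermitian (a : ℝ → ℝ) (n : ℕ) : (toep a n).IsHermitian := by
  ext i j
  simp only [toep, conjTranspose_apply, star_trivial]
  refine integral_congr_ae (ae_of_all _ fun l => ?_)
  simp only
  rw [← Real.cos_neg]; ring_nf

lemma integral_cos_int_mul (m : ℤ) :
    ∫ l, Real.cos (m * l) ∂circ = if m = 0 then 2 * Real.pi else 0 := by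
  rw [← intervalIntegral.integral_of_le (by linarith [Real.pi_pos])]
  split_ifs with h
  · simp [h]; ring
  · rw [intervalIntegral.integral_comp_mul_left _ (by exact_mod_cast h), integral_cos]
    rw [mul_neg, Real.sin_neg, Real.sin_int_mul_pi]; simp

lemma toep_cos (k n : ℕ) (i j : Fin n) :
    toep (fun l => Real.cos (k * l)) n i j =
      (if (i : ℕ) = j + k then Real.pi else 0) + (if (j : ℕ) = i + k then Real.pi else 0) := by
  have h : ∀ l : ℝ, Real.cos (k * l) * Real.cos ((((i : ℕ) : ℝ) - ((j : ℕ) : ℝ)) * l) =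
      Real.cos (((k - (i - j) : ℤ) : ℝ) * l) / 2 + Real.cos (((k + (i - j) : ℤ) : ℝ) * l) / 2 := by
    intro l
    push_cast
    rw [sub_mul (k : ℝ), add_mul (k : ℝ), Real.cos_sub, Real.cos_add]; ring
  have hi : ∀ m : ℤ, Integrable (fun l => Real.cos (m * l) / 2) circ := fun m => by
    have := (integrable_mul_cos (a := fun _ => 1) (integrable_const 1) (m : ℝ)).div_const 2
    simpa using this
  simp only [toep, h]
  rw [integral_add (hi _) (hi _), integral_div, integral_div, integral_cos_int_mul,
    integral_cos_int_mul]
  have e1 : ((k : ℤ) - (((i : ℕ) : ℤ) - ((j : ℕ) : ℤ)) = 0) ↔ ((i : ℕ) = j + k) := by omega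
  have e2 : ((k : ℤ) + (((i : ℕ) : ℤ) - ((j : ℕ) : ℤ)) = 0) ↔ ((j : ℕ) = i + k) := by omega
  simp only [e1, e2]
  congr 1 <;> split_ifs <;> ring

lemma toep_one (n : ℕ) (i j : Fin n) :
    toep (fun _ => 1) n i j = if i = j then 2 * Real.pi else 0 := by
  have := toep_cos 0 n i j
  simp only [Nat.cast_zero, zero_mul, Real.cos_zero, add_zero] at this
  rw [this]
  by_cases h : i = j
  · simp [h]; ring
  · have h1 : (i : ℕ) ≠ j := fun h' => h (Fin.ext h')
    simp [h, h1, h1.symm]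

lemma integral_trig_cross {n : ℕ} (x y : Fin n → ℝ) :
    ∫ l, ((∑ i, x i * Real.cos ((i : ℕ) * l)) * (∑ i, y i * Real.cos ((i : ℕ) * l)) +
      (∑ i, x i * Real.sin ((i : ℕ) * l)) * (∑ i, y i * Real.sin ((i : ℕ) * l))) ∂circ =
    2 * Real.pi * ∑ i, x i * y i := by
  have h := sum_mul_toep (a := fun _ => 1) (integrable_const 1) fun i j => x i * y j
  simp only [one_mul] at h
  simp only [trig_cross]
  rw [← h, Finset.mul_sum]
  refine Finset.sum_congr rfl fun i _ => ?_
  simp only [toep_one, mul_ite, mul_zero, Finset.sum_ite_eq, Finset.mem_univ, if_true]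
  ring

lemma integral_trigSq {n : ℕ} (x : Fin n → ℝ) :
    ∫ l, trigSq x l ∂circ = 2 * Real.pi * ∑ i, x i ^ 2 := by
  have := integral_trig_cross x x
  simp only [← pow_two] at this
  exact this

/-- The Toeplitz matrix of an almost everywhere positive weight is positive definite. -/
lemma toep_posDef {F : ℝ → ℝ} (hF : Integrable F circ) (hpos : ∀ᵐ l ∂circ, 0 < F l) (n : ℕ) :
    (toep F n).PosDef := by
  refine PosDef.of_dotProduct_mulVec_pos (toep_isHermitian F n) fun x hx => ?_
  rw [star_trivial, ← qForm_eq_dotProduct, qForm_toep hF]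
  have hnn : 0 ≤ᵐ[circ] fun l => F l * trigSq x l := by
    filter_upwards [hpos] with l hl using mul_nonneg hl.le (trigSq_nonneg x l)
  refine lt_of_le_of_ne (integral_nonneg_of_ae hnn) fun h => hx ?_
  have h0 := (integral_eq_zero_iff_of_nonneg_ae hnn (integrable_mul_trigSq hF x)).1 h.symm
  have h1 : trigSq x =ᵐ[circ] 0 := by
    filter_upwards [h0, hpos] with l hl hl'
    exact (mul_eq_zero.1 hl).resolve_left hl'.ne'
  have h2 := integral_trigSq x
  rw [integral_congr_ae h1] at h2
  have h3 : ∑ i, x i ^ 2 = 0 := by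
    have : 2 * Real.pi * ∑ i, x i ^ 2 = 0 := by rw [← h2]; simp
    exact (mul_eq_zero.1 this).resolve_left (by positivity)
  ext i
  have := (Finset.sum_eq_zero_iff_of_nonneg fun i _ => sq_nonneg (x i)).1 h3 i (Finset.mem_univ i)
  simpa using this

/-- Duality bound: Cauchy–Schwarz with weights `F` and `F⁻¹`. -/
lemma two_mul_dot_le {F : ℝ → ℝ} (hF : Integrable F circ) (hpos : ∀ᵐ l ∂circ, 0 < F l)
    (hFi : Integrable (fun l => (F l)⁻¹) circ) {n : ℕ} (x y : Fin n → ℝ) :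
    2 * ∑ i, x i * y i ≤ qForm (toep F n) y +
      1 / (4 * Real.pi ^ 2) * qForm (toep (fun l => (F l)⁻¹) n) x := by
  rw [qForm_toep hF, qForm_toep hFi, ← integral_const_mul,
    ← integral_add (integrable_mul_trigSq hF y) ((integrable_mul_trigSq hFi x).const_mul _)]
  have h := integral_trig_cross x y
  have h' : 2 * ∑ i, x i * y i = ∫ l, (1 / Real.pi) *
      ((∑ i, x i * Real.cos ((i : ℕ) * l)) * (∑ i, y i * Real.cos ((i : ℕ) * l)) +
      (∑ i, x i * Real.sin ((i : ℕ) * l)) * (∑ i, y i * Real.sin ((i : ℕ) * l))) ∂circ := by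
    rw [integral_const_mul, h]; field_simp
  rw [h']
  refine integral_mono_ae ?_ ?_ ?_
  · exact (Continuous.integrableOn_Ioc (by fun_prop))
  · exact (integrable_mul_trigSq hF y).add ((integrable_mul_trigSq hFi x).const_mul _)
  · filter_upwards [hpos] with l hl
    simp only [trigSq]
    set c := ∑ i, x i * Real.cos ((i : ℕ) * l)
    set c' := ∑ i, y i * Real.cos ((i : ℕ) * l)
    set s := ∑ i, x i * Real.sin ((i : ℕ) * l)
    set s' := ∑ i, y i * Real.sin ((i : ℕ) * l)
    have key : ∀ u v : ℝ, 1 / Real.pi * (u * v) ≤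
        F l * v ^ 2 + 1 / (4 * Real.pi ^ 2) * ((F l)⁻¹ * u ^ 2) := by
      intro u v
      have : F l * v ^ 2 + 1 / (4 * Real.pi ^ 2) * ((F l)⁻¹ * u ^ 2) - 1 / Real.pi * (u * v) =
          (F l)⁻¹ * (F l * v - u / (2 * Real.pi)) ^ 2 := by
        field_simp; ring
      have h2 : 0 ≤ (F l)⁻¹ * (F l * v - u / (2 * Real.pi)) ^ 2 := by positivity
      linarith
    linarith [key c c', key s s']

lemma dot_mulVec_of_transpose_mul {n : ℕ} {T B : Matrix (Fin n) (Fin n) ℝ} (hB : Bᵀ * T * B = 1)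
    (w : Fin n → ℝ) : qForm T (B *ᵥ w) = ∑ i, w i ^ 2 := by
  rw [qForm_mulVec, hB, ← diagonal_one, qForm_diagonal]
  simp

/-- Bessel-type bound for a basis orthonormal with respect to `toep F n`. -/
lemma sum_sq_dot_le {F : ℝ → ℝ} (hF : Integrable F circ) (hpos : ∀ᵐ l ∂circ, 0 < F l)
    (hFi : Integrable (fun l => (F l)⁻¹) circ) {n : ℕ} {B : Matrix (Fin n) (Fin n) ℝ}
    (hB : Bᵀ * toep F n * B = 1) (x : Fin n → ℝ) :
    ∑ k, (∑ i, x i * B i k) ^ 2 ≤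
      1 / (4 * Real.pi ^ 2) * qForm (toep (fun l => (F l)⁻¹) n) x := by
  set w : Fin n → ℝ := fun k => ∑ i, x i * B i k with hw
  have h := two_mul_dot_le hF hpos hFi x (B *ᵥ w)
  rw [dot_mulVec_of_transpose_mul hB] at h
  have h2 : ∑ i, x i * (B *ᵥ w) i = ∑ k, w k ^ 2 := by
    simp only [mulVec, dotProduct, Finset.mul_sum]
    rw [Finset.sum_comm]
    refine Finset.sum_congr rfl fun k _ => ?_
    rw [pow_two]
    conv_rhs => rw [hw]
    simp only [Finset.sum_mul]
    exact Finset.sum_congr rfl fun i _ => by ring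
  rw [h2] at h
  linarith

lemma sum_toep_mul_cos_eq {a : ℝ → ℝ} (n : ℕ) (l : ℝ) :
    ∑ i, ∑ j, toep a n i j * Real.cos ((((i : ℕ) : ℝ) - ((j : ℕ) : ℝ)) * l) =
      qForm (toep a n) (fun i => Real.cos ((i : ℕ) * l)) +
      qForm (toep a n) (fun i => Real.sin ((i : ℕ) * l)) := by
  simp only [qForm, ← Finset.sum_add_distrib]
  refine Finset.sum_congr rfl fun i _ => Finset.sum_congr rfl fun j _ => ?_
  rw [sub_mul, Real.cos_sub]; ring

lemma sum_toep_mul_cos_nonneg {a : ℝ → ℝ} (ha : Integrable a circ) (hnn : 0 ≤ᵐ[circ] a)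
    (n : ℕ) (l : ℝ) :
    0 ≤ ∑ i, ∑ j, toep a n i j * Real.cos ((((i : ℕ) : ℝ) - ((j : ℕ) : ℝ)) * l) := by
  rw [sum_toep_mul_cos_eq, qForm_toep ha, qForm_toep ha]
  refine add_nonneg ?_ ?_ <;>
  · refine integral_nonneg_of_ae ?_
    filter_upwards [hnn] with l hl using mul_nonneg hl (trigSq_nonneg _ l)

lemma toepPair_eq {a b : ℝ → ℝ} (hb : Integrable b circ) (n : ℕ) :
    toepPair a b n = ∫ l, b l *
      ∑ i, ∑ j, toep a n i j * Real.cos ((((i : ℕ) : ℝ) - ((j : ℕ) : ℝ)) * l) ∂circ :=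
  sum_mul_toep hb _

lemma toepPair_comm (a b : ℝ → ℝ) (n : ℕ) : toepPair a b n = toepPair b a n := by
  simp only [toepPair, mul_comm]

lemma integrable_mul_sum_toep {a b : ℝ → ℝ} (hb : Integrable b circ) (n : ℕ) :
    Integrable (fun l => b l *
      ∑ i, ∑ j, toep a n i j * Real.cos ((((i : ℕ) : ℝ) - ((j : ℕ) : ℝ)) * l)) circ := by
  simp only [Finset.mul_sum, mul_left_comm (b _)]
  exact integrable_finsetSum _ fun i _ => integrable_finsetSum _ fun j _ =>
    (integrable_mul_cos hb _).const_mul _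

/-- The trace of `T_n(F)⁻¹ T_n(g)` is bounded by that of `T_n(1/F) T_n(g) / (4π²)`. -/
lemma sum_qForm_col_le {F g : ℝ → ℝ} (hF : Integrable F circ) (hpos : ∀ᵐ l ∂circ, 0 < F l)
    (hFi : Integrable (fun l => (F l)⁻¹) circ) (hg : Integrable g circ) (hg0 : 0 ≤ᵐ[circ] g)
    {n : ℕ} {B : Matrix (Fin n) (Fin n) ℝ} (hB : Bᵀ * toep F n * B = 1) :
    ∑ k, qForm (toep g n) (fun i => B i k) ≤
      1 / (4 * Real.pi ^ 2) * toepPair (fun l => (F l)⁻¹) g n := by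
  simp only [qForm_toep hg]
  rw [← integral_finsetSum _ fun k _ => integrable_mul_trigSq hg _, toepPair_eq hg,
    ← integral_const_mul]
  refine integral_mono_ae (integrable_finsetSum _ fun k _ => integrable_mul_trigSq hg _)
    ((integrable_mul_sum_toep hg n).const_mul _) ?_
  filter_upwards [hg0] with l hl
  rw [← Finset.mul_sum, mul_left_comm]
  refine mul_le_mul_of_nonneg_left ?_ hl
  rw [sum_toep_mul_cos_eq, mul_add]
  simp only [trigSq, Finset.sum_add_distrib]
  have h1 := sum_sq_dot_le hF hpos hFi hB fun i => Real.cos ((i : ℕ) * l)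
  have h2 := sum_sq_dot_le hF hpos hFi hB fun i => Real.sin ((i : ℕ) * l)
  simp only [mul_comm (B _ _)]
  exact add_le_add h1 h2

lemma sum_sum_ite_eq_add (k n : ℕ) :
    ∑ i : Fin n, ∑ j : Fin n, (if (i : ℕ) = j + k then (1 : ℝ) else 0) = ((n - k : ℕ) : ℝ) := by
  rw [Finset.sum_comm]
  have h : ∀ j : Fin n, ∑ i : Fin n, (if (i : ℕ) = j + k then (1 : ℝ) else 0) =
      if (j : ℕ) < n - k then 1 else 0 := by
    intro j
    rw [Fin.sum_univ_eq_sum_range (fun i : ℕ => if i = (j : ℕ) + k then (1 : ℝ) else 0) n,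
      Finset.sum_ite_eq']
    congr 1
    rw [Finset.mem_range]
    exact propext ⟨fun _ => by omega, fun _ => by omega⟩
  simp only [h]
  rw [Fin.sum_univ_eq_sum_range (fun j : ℕ => if j < n - k then (1 : ℝ) else 0) n,
    Finset.sum_ite, Finset.sum_const_zero, add_zero, Finset.sum_const, nsmul_eq_mul, mul_one]
  congr 1
  rw [show (Finset.range n).filter (fun j => j < n - k) = Finset.range (n - k) by
    ext j; simp only [Finset.mem_filter, Finset.mem_range]; omega, Finset.card_range]

lemma toepPair_cos (a : ℝ → ℝ) (k n : ℕ) :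
    toepPair a (fun l => Real.cos (k * l)) n =
      2 * Real.pi * (∫ l, a l * Real.cos (k * l) ∂circ) * ((n - k : ℕ) : ℝ) := by
  set A := ∫ l, a l * Real.cos (k * l) ∂circ with hA
  have h : ∀ i j : Fin n, toep a n i j * toep (fun l => Real.cos (k * l)) n i j =
      Real.pi * A * (if (i : ℕ) = j + k then (1 : ℝ) else 0) +
      Real.pi * A * (if (j : ℕ) = i + k then (1 : ℝ) else 0) := by
    intro i j
    rw [toep_cos, mul_add]
    congr 1
    · split_ifs with h
      · have : toep a n i j = A := by
          rw [toep, hA, h]; push_cast; congr 1; ext l; congr 2; ring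
        rw [this]; ring
      · simp
    · split_ifs with h
      · have : toep a n i j = A := by
          rw [toep, hA, h]; push_cast; congr 1; ext l; rw [← Real.cos_neg]; congr 2; ring
        rw [this]; ring
      · simp
  simp only [toepPair, h, Finset.sum_add_distrib, ← Finset.mul_sum]
  rw [Finset.sum_comm (f := fun i j : Fin n => if (j : ℕ) = i + k then (1 : ℝ) else 0),
    sum_sum_ite_eq_add]
  ring

/-- Szegő-type limit for the pairing of two Toeplitz matrices. -/
def PairLim (a b : ℝ → ℝ) : Prop :=
  Tendsto (fun n : ℕ => toepPair a b n / n) atTop (𝓝 (2 * Real.pi * ∫ l, a l * b l ∂circ))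

lemma pairLim_cos (a : ℝ → ℝ) (k : ℕ) : PairLim a fun l => Real.cos (k * l) := by
  have h : Tendsto (fun n : ℕ => 1 - (k : ℝ) / n) atTop (𝓝 (1 - 0)) :=
    tendsto_const_nhds.sub (tendsto_const_div_atTop_nhds_zero_nat _)
  have h2 := h.const_mul (2 * Real.pi * ∫ l, a l * Real.cos (k * l) ∂circ)
  rw [sub_zero, mul_one] at h2
  refine h2.congr' ?_
  filter_upwards [eventually_ge_atTop (k + 1)] with n hn
  have hn0 : (n : ℝ) ≠ 0 := by
    have : n ≠ 0 := by omega
    exact_mod_cast this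
  rw [toepPair_cos, Nat.cast_sub (by omega)]
  field_simp

lemma toep_add {b c : ℝ → ℝ} (hb : Integrable b circ) (hc : Integrable c circ) (n : ℕ) :
    toep (fun l => b l + c l) n = toep b n + toep c n := by
  ext i j
  simp only [toep, add_mul, Matrix.add_apply]
  exact integral_add (integrable_mul_cos hb _) (integrable_mul_cos hc _)

lemma toep_const_mul (r : ℝ) (b : ℝ → ℝ) (n : ℕ) :
    toep (fun l => r * b l) n = r • toep b n := by
  ext i j
  simp only [toep, mul_assoc, Matrix.smul_apply, smul_eq_mul]
  exact integral_const_mul _ _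

lemma toepPair_add {a b c : ℝ → ℝ} (hb : Integrable b circ) (hc : Integrable c circ) (n : ℕ) :
    toepPair a (fun l => b l + c l) n = toepPair a b n + toepPair a c n := by
  simp only [toepPair, toep_add hb hc, Matrix.add_apply, mul_add, Finset.sum_add_distrib]

lemma toepPair_const_mul (a : ℝ → ℝ) (r : ℝ) (b : ℝ → ℝ) (n : ℕ) :
    toepPair a (fun l => r * b l) n = r * toepPair a b n := by
  simp only [toepPair, toep_const_mul, Matrix.smul_apply, smul_eq_mul, Finset.mul_sum]
  exact Finset.sum_congr rfl fun i _ => Finset.sum_congr rfl fun j _ => by ring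

lemma integrable_mul_of_continuous {a b : ℝ → ℝ} (ha : Integrable a circ) (hb : Continuous b) :
    Integrable (fun l => a l * b l) circ := by
  obtain ⟨C, hC⟩ := (isCompact_Icc (a := -Real.pi) (b := Real.pi)).exists_bound_of_continuousOn
    hb.continuousOn
  refine ha.mul_bdd (c := C) hb.aestronglyMeasurable ?_
  filter_upwards [ae_restrict_mem measurableSet_Ioc] with l hl
  exact hC l ⟨hl.1.le, hl.2⟩

lemma Continuous.integrable_circ {b : ℝ → ℝ} (hb : Continuous b) : Integrable b circ := by
  simpa using integrable_mul_of_continuous (a := fun _ => (1 : ℝ)) (integrable_const 1) hb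

lemma PairLim.add {a b c : ℝ → ℝ} (ha : Integrable a circ) (hb : Continuous b) (hc : Continuous c)
    (h1 : PairLim a b) (h2 : PairLim a c) : PairLim a fun l => b l + c l := by
  have h := Tendsto.add h1 h2
  unfold PairLim
  simp only [mul_add]
  rw [integral_add (integrable_mul_of_continuous ha hb) (integrable_mul_of_continuous ha hc),
    mul_add]
  refine h.congr fun n => ?_
  rw [toepPair_add hb.integrable_circ hc.integrable_circ, add_div]

lemma PairLim.const_mul {a b : ℝ → ℝ} (r : ℝ) (h : PairLim a b) :
    PairLim a fun l => r * b l := by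
  have h := Tendsto.const_mul r h
  unfold PairLim
  simp only [mul_left_comm (a _) r]
  rw [integral_const_mul, mul_left_comm]
  refine h.congr fun n => ?_
  rw [toepPair_const_mul, mul_div_assoc]

lemma pairLim_cos_mul_pow {a : ℝ → ℝ} (ha : Integrable a circ) (m : ℕ) : ∀ k : ℕ,
    PairLim a fun l => Real.cos (k * l) * Real.cos l ^ m := by
  induction m with
  | zero => intro k; simpa using pairLim_cos a k
  | succ m ih =>
    intro k
    rcases k with _ | k
    · convert ih 1 using 2 with l
      simp [pow_succ']
    · have h := ((ih (k + 2)).add ha (by fun_prop) (by fun_prop) (ih k)).const_mul (1 / 2)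
      convert h using 2 with l
      have e1 : ((k + 2 : ℕ) : ℝ) * l = ((k + 1 : ℕ) : ℝ) * l + l := by push_cast; ring
      have e2 : (k : ℝ) * l = ((k + 1 : ℕ) : ℝ) * l - l := by push_cast; ring
      rw [e1, e2, Real.cos_add, Real.cos_sub, pow_succ']
      ring

lemma pairLim_polynomial {a : ℝ → ℝ} (ha : Integrable a circ) (p : Polynomial ℝ) :
    PairLim a fun l => p.eval (Real.cos l) := by
  induction p using Polynomial.induction_on' with
  | add p q hp hq =>
    simp only [Polynomial.eval_add]
    exact hp.add ha (by fun_prop) (by fun_prop) hq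
  | monomial m r =>
    simp only [Polynomial.eval_monomial]
    refine PairLim.const_mul r ?_
    simpa using pairLim_cos_mul_pow ha m 0

lemma abs_toepPair_le {a b : ℝ → ℝ} (ha : Integrable a circ) (hnn : 0 ≤ᵐ[circ] a)
    (hb : Integrable b circ) {δ : ℝ} (hδ : ∀ᵐ l ∂circ, |b l| ≤ δ) (n : ℕ) :
    |toepPair a b n| ≤ δ * (2 * Real.pi * (∫ l, a l ∂circ)) * n := by
  have h1 : toepPair a (fun _ => δ) n = δ * (2 * Real.pi * (∫ l, a l ∂circ)) * n := by
    have := toepPair_const_mul a δ (fun _ => 1) n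
    simp only [mul_one] at this
    rw [this]
    have := toepPair_cos a 0 n
    simp only [Nat.cast_zero, zero_mul, Real.cos_zero, mul_one, Nat.sub_zero] at this
    rw [this]; ring
  rw [← h1, toepPair_eq hb, toepPair_eq (integrable_const δ)]
  refine (abs_integral_le_integral_abs).trans (integral_mono_ae ?_ ?_ ?_)
  · exact (integrable_mul_sum_toep hb n).abs
  · exact integrable_mul_sum_toep (integrable_const δ) n
  · filter_upwards [hδ] with l hl
    rw [abs_mul, abs_of_nonneg (sum_toep_mul_cos_nonneg ha hnn n l)]
    exact mul_le_mul_of_nonneg_right hl (sum_toep_mul_cos_nonneg ha hnn n l)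

lemma PairLim.of_approx {a b : ℝ → ℝ} (ha : Integrable a circ) (hnn : 0 ≤ᵐ[circ] a)
    (hb : Integrable b circ)
    (happ : ∀ δ > 0, ∃ p : Polynomial ℝ, ∀ᵐ l ∂circ, |b l - p.eval (Real.cos l)| ≤ δ) :
    PairLim a b := by
  set I := ∫ l, a l ∂circ with hI
  have hI0 : 0 ≤ I := integral_nonneg_of_ae hnn
  have hpi := Real.pi_pos
  unfold PairLim
  rw [Metric.tendsto_atTop]
  intro ε hε
  obtain ⟨p, hp⟩ := happ (ε / (3 * (2 * Real.pi * I + 1))) (by positivity)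
  set δ := ε / (3 * (2 * Real.pi * I + 1)) with hδ
  have hδ' : δ * (2 * Real.pi * I) ≤ ε / 3 := by
    rw [hδ, div_mul_eq_mul_div, div_le_div_iff₀ (by positivity) (by norm_num)]
    nlinarith
  obtain ⟨N, hN⟩ := (Metric.tendsto_atTop.1 (pairLim_polynomial ha p)) (ε / 3) (by positivity)
  have hpc : Continuous fun l => p.eval (Real.cos l) := by fun_prop
  have hd : Integrable (fun l => b l - p.eval (Real.cos l)) circ := hb.sub hpc.integrable_circ
  have hdm : Integrable (fun l => a l * (b l - p.eval (Real.cos l))) circ :=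
    ha.mul_bdd (c := δ) hd.aestronglyMeasurable (by simpa using hp)
  refine ⟨N + 1, fun n hn => ?_⟩
  have hn0 : (0 : ℝ) < n := by
    have : 0 < n := by omega
    exact_mod_cast this
  have h1 := hN n (by omega)
  rw [Real.dist_eq] at h1 ⊢
  have h2 : toepPair a b n = toepPair a (fun l => b l - p.eval (Real.cos l)) n +
      toepPair a (fun l => p.eval (Real.cos l)) n := by
    rw [← toepPair_add hd hpc.integrable_circ]; simp
  have h3 : ∫ l, a l * b l ∂circ = ∫ l, a l * (b l - p.eval (Real.cos l)) ∂circ +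
      ∫ l, a l * p.eval (Real.cos l) ∂circ := by
    rw [← integral_add hdm (integrable_mul_of_continuous ha hpc)]
    congr 1; ext l; ring
  have h4 := abs_toepPair_le ha hnn hd hp n
  have h5 : |∫ l, a l * (b l - p.eval (Real.cos l)) ∂circ| ≤ δ * I := by
    rw [hI, ← integral_const_mul]
    refine (abs_integral_le_integral_abs).trans (integral_mono_ae hdm.abs (ha.const_mul δ) ?_)
    filter_upwards [hp, hnn] with l hl hl'
    rw [abs_mul, abs_of_nonneg hl', mul_comm]
    exact mul_le_mul_of_nonneg_right hl hl'
  have h6 : |toepPair a (fun l => b l - p.eval (Real.cos l)) n / n| ≤ ε / 3 := by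
    rw [abs_div, abs_of_pos hn0, div_le_iff₀ hn0]
    exact h4.trans (mul_le_mul_of_nonneg_right hδ' hn0.le)
  rw [h2, h3, add_div, mul_add]
  rw [abs_lt] at h1 ⊢
  rw [abs_le] at h5 h6
  have h7 : 2 * Real.pi * (δ * I) ≤ ε / 3 := by linarith
  have h8 := mul_le_mul_of_nonneg_left h5.1 (by positivity : 0 ≤ 2 * Real.pi)
  have h9 := mul_le_mul_of_nonneg_left h5.2 (by positivity : 0 ≤ 2 * Real.pi)
  constructor <;> linarith

/-- The pairing limit for an integrable nonnegative weight and an even continuous one. -/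
lemma pairLim_of_continuousOn {a b β : ℝ → ℝ} (ha : Integrable a circ) (hnn : 0 ≤ᵐ[circ] a)
    (hβ : ContinuousOn β (Set.Icc 0 Real.pi)) (hbβ : ∀ᵐ l ∂circ, b l = β |l|)
    (hb : Integrable b circ) : PairLim a b := by
  refine PairLim.of_approx ha hnn hb fun δ hδ => ?_
  have hc : ContinuousOn (fun x => β (Real.arccos x)) (Set.Icc (-1) 1) :=
    hβ.comp Real.continuous_arccos.continuousOn
      fun x _ => ⟨Real.arccos_nonneg x, Real.arccos_le_pi x⟩
  obtain ⟨p, hp⟩ := exists_polynomial_near_of_continuousOn (-1) 1 _ hc δ hδ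
  refine ⟨p, ?_⟩
  filter_upwards [hbβ, ae_restrict_mem measurableSet_Ioc] with l hl hl'
  have h := hp (Real.cos l) ⟨Real.neg_one_le_cos l, Real.cos_le_one l⟩
  rw [← Real.cos_abs, Real.arccos_cos (abs_nonneg l) (abs_le.2 ⟨hl'.1.le, hl'.2⟩),
    Real.cos_abs] at h
  rw [hl, abs_sub_comm]
  exact h.le

lemma setLIntegral_ofReal_eq {s : Set ℝ} (hs : MeasurableSet s) {f : ℝ → ℝ} {c : ℝ}
    (hf : ∀ x ∈ s, 0 ≤ f x) (hc : c ≠ 0) (h : ∫ x in s, f x = c) :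
    ∫⁻ x in s, ENNReal.ofReal (f x) = ENNReal.ofReal c := by
  rw [← h, ofReal_integral_eq_lintegral_ofReal]
  · exact Integrable.of_integral_ne_zero (by rwa [h])
  · filter_upwards [ae_restrict_mem hs] with x hx using hf x hx

lemma lintegral_rpow_mul_exp_neg_mul {a r : ℝ} (ha : 0 < a) (hr : 0 < r) :
    ∫⁻ t in Set.Ioi (0 : ℝ), ENNReal.ofReal (t ^ (a - 1) * Real.exp (-(r * t))) =
      ENNReal.ofReal ((1 / r) ^ a * Real.Gamma a) := by
  refine setLIntegral_ofReal_eq measurableSet_Ioi (fun x hx => ?_) ?_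
    (Real.integral_rpow_mul_exp_neg_mul_Ioi ha hr)
  · have : (0 : ℝ) < x := hx
    positivity
  · have := Real.Gamma_pos_of_pos ha
    positivity

lemma lintegral_rpow_div_one_add_sq {b : ℝ} (hb : 0 < b) (hb2 : b < 2) :
    ∫⁻ s in Set.Ioi (0 : ℝ), ENNReal.ofReal (s ^ (b - 1) / (1 + s ^ 2)) =
      ENNReal.ofReal (Real.pi / (2 * Real.sin (Real.pi * b / 2))) := by
  have h1 : ∀ s ∈ Set.Ioi (0 : ℝ), ENNReal.ofReal (s ^ (b - 1) / (1 + s ^ 2)) =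
      ∫⁻ u in Set.Ioi (0 : ℝ), ENNReal.ofReal (s ^ (b - 1) * Real.exp (-((1 + s ^ 2) * u))) := by
    intro s hs
    have hs' : (0 : ℝ) < s := hs
    have := lintegral_rpow_mul_exp_neg_mul (a := 1) (r := 1 + s ^ 2) one_pos (by positivity)
    simp only [sub_self, Real.rpow_zero, one_mul, Real.rpow_one, Real.Gamma_one, mul_one] at this
    simp only [ENNReal.ofReal_mul (Real.rpow_nonneg hs'.le (b - 1))]
    rw [lintegral_const_mul _ (by fun_prop), this, ← ENNReal.ofReal_mul (by positivity)]
    congr 1; ring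
  rw [setLIntegral_congr_fun measurableSet_Ioi h1, lintegral_lintegral_swap (by fun_prop)]
  have hg1 := Real.Gamma_pos_of_pos (show 0 < b / 2 by linarith)
  have h2 : ∀ u ∈ Set.Ioi (0 : ℝ),
      ∫⁻ s in Set.Ioi (0 : ℝ), ENNReal.ofReal (s ^ (b - 1) * Real.exp (-((1 + s ^ 2) * u))) =
      ENNReal.ofReal (1 / 2 * Real.Gamma (b / 2)) *
        ENNReal.ofReal (u ^ ((1 - b / 2) - 1) * Real.exp (-(1 * u))) := by
    intro u hu
    have hu' : (0 : ℝ) < u := hu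
    have := setLIntegral_ofReal_eq measurableSet_Ioi (fun x hx => ?_) ?_
      (integral_rpow_mul_exp_neg_mul_rpow (p := 2) (q := b - 1) two_pos (by linarith) hu')
    · have h3 : ∀ s : ℝ, s ^ (b - 1) * Real.exp (-((1 + s ^ 2) * u)) =
          Real.exp (-u) * (s ^ (b - 1) * Real.exp (-u * s ^ (2 : ℝ))) := by
        intro s
        rw [mul_left_comm, ← Real.exp_add, Real.rpow_two]; ring_nf
      simp only [h3, ENNReal.ofReal_mul (Real.exp_nonneg (-u))]
      rw [lintegral_const_mul _ (by fun_prop), this, ← ENNReal.ofReal_mul (by positivity),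
        ← ENNReal.ofReal_mul (by positivity)]
      congr 1
      rw [show -(b - 1 + 1) / 2 = 1 - b / 2 - 1 by ring, show (b - 1 + 1) / 2 = b / 2 by ring,
        one_mul]
      ring
    · have : (0 : ℝ) < x := hx
      positivity
    · have : 0 < Real.Gamma ((b - 1 + 1) / 2) := by rwa [sub_add_cancel]
      positivity
  rw [setLIntegral_congr_fun measurableSet_Ioi h2, lintegral_const_mul _ (by fun_prop),
    lintegral_rpow_mul_exp_neg_mul (by linarith) one_pos, ← ENNReal.ofReal_mul (by positivity)]
  congr 1
  have h4 := Real.Gamma_mul_Gamma_one_sub (b / 2)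
  rw [div_one, Real.one_rpow, one_mul, mul_assoc, h4, mul_div_assoc, div_mul_div_comm, one_mul]

lemma setIntegral_one_sub_cos_mul_exp {s : ℝ} (hs : 0 < s) :
    ∫ x in Set.Ioi (0 : ℝ), (1 - Real.cos x) * Real.exp (-(x * s)) = 1 / (s * (1 + s ^ 2)) := by
  set g : ℝ → ℝ := fun x => Real.exp (-(x * s)) *
    ((Real.sin x * -s + s ^ 2 * Real.cos x) / (s * (1 + s ^ 2)) - 1 / s) with hg
  have hd : ∀ x ∈ Set.Ici (0 : ℝ),
      HasDerivAt g ((1 - Real.cos x) * Real.exp (-(x * s))) x := by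
    intro x _
    have h1 : HasDerivAt (fun x : ℝ => Real.exp (-(x * s))) (Real.exp (-(x * s)) * -(1 * s)) x :=
      ((hasDerivAt_id x).mul_const s).neg.exp
    have h2 : HasDerivAt (fun x : ℝ => (Real.sin x * -s + s ^ 2 * Real.cos x) / (s * (1 + s ^ 2))
        - 1 / s) ((Real.cos x * -s + s ^ 2 * -Real.sin x) / (s * (1 + s ^ 2))) x :=
      ((((Real.hasDerivAt_sin x).mul_const _).add
        ((Real.hasDerivAt_cos x).const_mul _)).div_const _).sub_const _
    refine (h1.mul h2).congr_deriv ?_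
    field_simp
    ring
  have hl : Tendsto g atTop (𝓝 0) := by
    have h1 : Tendsto (fun x : ℝ => Real.exp (-(x * s))) atTop (𝓝 0) :=
      Real.tendsto_exp_neg_atTop_nhds_zero.comp (tendsto_id.atTop_mul_const hs)
    refine h1.zero_mul_isBoundedUnder_le ?_
    refine ⟨(s + s ^ 2) / (s * (1 + s ^ 2)) + 1 / s, eventually_map.2 (Eventually.of_forall fun x => ?_)⟩
    simp only [Function.comp, Real.norm_eq_abs]
    have ha : |Real.sin x * -s + s ^ 2 * Real.cos x| ≤ s + s ^ 2 := by
      have := Real.sin_le_one x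
      have := Real.neg_one_le_sin x
      have := Real.cos_le_one x
      have := Real.neg_one_le_cos x
      rw [abs_le]; constructor <;> nlinarith [sq_nonneg s]
    refine (abs_sub _ _).trans ?_
    rw [abs_div, abs_of_pos (show 0 < s * (1 + s ^ 2) by positivity),
      abs_of_pos (show 0 < 1 / s by positivity)]
    gcongr
  rw [integral_Ioi_of_hasDerivAt_of_nonneg' hd (fun x _ => mul_nonneg
    (by linarith [Real.cos_le_one x]) (Real.exp_nonneg _)) hl, hg]
  simp only [zero_mul, neg_zero, Real.exp_zero, Real.sin_zero, Real.cos_zero]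
  field_simp
  ring

/-- `∫₀^∞ (1 - cos x) x^{-1-b} dx`. -/
def oneSubCosConst (b : ℝ) : ℝ :=
  Real.pi / (2 * Real.Gamma (1 + b) * Real.sin (Real.pi * b / 2))

lemma sin_pi_mul_half_pos {b : ℝ} (hb : 0 < b) (hb2 : b < 2) : 0 < Real.sin (Real.pi * b / 2) :=
  Real.sin_pos_of_pos_of_lt_pi (by positivity) (by nlinarith [Real.pi_pos])

lemma oneSubCosConst_pos {b : ℝ} (hb : 0 < b) (hb2 : b < 2) : 0 < oneSubCosConst b := by
  have h1 := sin_pi_mul_half_pos hb hb2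
  have h2 := Real.Gamma_pos_of_pos (show 0 < 1 + b by linarith)
  have := Real.pi_pos
  unfold oneSubCosConst
  positivity

lemma lintegral_one_sub_cos_mul_rpow {b : ℝ} (hb : 0 < b) (hb2 : b < 2) :
    ∫⁻ x in Set.Ioi (0 : ℝ), ENNReal.ofReal ((1 - Real.cos x) * x ^ (-1 - b)) =
      ENNReal.ofReal (oneSubCosConst b) := by
  have hG := Real.Gamma_pos_of_pos (show 0 < 1 + b by linarith)
  have hcos : ∀ x : ℝ, 0 ≤ 1 - Real.cos x := fun x => by linarith [Real.cos_le_one x]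
  have h1 : ∀ x ∈ Set.Ioi (0 : ℝ), ENNReal.ofReal ((1 - Real.cos x) * x ^ (-1 - b)) =
      ENNReal.ofReal (1 / Real.Gamma (1 + b)) * ∫⁻ s in Set.Ioi (0 : ℝ),
        ENNReal.ofReal (s ^ b * ((1 - Real.cos x) * Real.exp (-(x * s)))) := by
    intro x hx
    have hx' : (0 : ℝ) < x := hx
    have h := lintegral_rpow_mul_exp_neg_mul (a := 1 + b) (r := x) (by linarith) hx'
    have h2 : ∀ s : ℝ, s ^ b * ((1 - Real.cos x) * Real.exp (-(x * s))) =
        (1 - Real.cos x) * (s ^ (1 + b - 1) * Real.exp (-(x * s))) := by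
      intro s; rw [add_sub_cancel_left]; ring
    simp only [h2, ENNReal.ofReal_mul (hcos x)]
    rw [lintegral_const_mul _ (by fun_prop), h, ← ENNReal.ofReal_mul (hcos x),
      ← ENNReal.ofReal_mul (hcos x), ← ENNReal.ofReal_mul (by positivity)]
    congr 1
    rw [one_div x, Real.inv_rpow hx'.le, ← Real.rpow_neg hx'.le, neg_add, ← sub_eq_add_neg]
    field_simp
  rw [setLIntegral_congr_fun measurableSet_Ioi h1, lintegral_const_mul' _ _ ENNReal.ofReal_ne_top,
    lintegral_lintegral_swap (by fun_prop)]
  have h3 : ∀ s ∈ Set.Ioi (0 : ℝ), ∫⁻ x in Set.Ioi (0 : ℝ),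
      ENNReal.ofReal (s ^ b * ((1 - Real.cos x) * Real.exp (-(x * s)))) =
      ENNReal.ofReal (s ^ (b - 1) / (1 + s ^ 2)) := by
    intro s hs
    have hs' : (0 : ℝ) < s := hs
    simp only [ENNReal.ofReal_mul (Real.rpow_nonneg hs'.le b)]
    rw [lintegral_const_mul _ (by fun_prop), setLIntegral_ofReal_eq measurableSet_Ioi
      (fun x _ => mul_nonneg (hcos x) (Real.exp_nonneg _)) (by positivity)
      (setIntegral_one_sub_cos_mul_exp hs'), ← ENNReal.ofReal_mul (by positivity)]
    congr 1
    rw [Real.rpow_sub_one hs'.ne']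
    field_simp
  rw [setLIntegral_congr_fun measurableSet_Ioi h3, lintegral_rpow_div_one_add_sq hb hb2,
    ← ENNReal.ofReal_mul (by positivity)]
  congr 1
  rw [oneSubCosConst, div_mul_div_comm, one_mul]
  ring_nf

lemma integrableOn_and_integral_of_lintegral {s : Set ℝ} (hs : MeasurableSet s) {f : ℝ → ℝ} {c : ℝ}
    (hm : Measurable f) (hf : ∀ x ∈ s, 0 ≤ f x) (hc : 0 ≤ c)
    (h : ∫⁻ x in s, ENNReal.ofReal (f x) = ENNReal.ofReal c) :
    IntegrableOn f s ∧ ∫ x in s, f x = c := by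
  have hnn : 0 ≤ᵐ[volume.restrict s] f := by
    filter_upwards [ae_restrict_mem hs] with x hx using hf x hx
  refine ⟨(lintegral_ofReal_ne_top_iff_integrable hm.aestronglyMeasurable hnn).1
    (by rw [h]; exact ENNReal.ofReal_ne_top), ?_⟩
  rw [integral_eq_lintegral_of_nonneg_ae hnn hm.aestronglyMeasurable, h, ENNReal.toReal_ofReal hc]

lemma integral_one_sub_cos_mul {b : ℝ} (hb : 0 < b) (hb2 : b < 2) (t : ℝ) :
    IntegrableOn (fun x : ℝ => (1 - Real.cos (t * x)) * x ^ (-1 - b)) (Set.Ioi 0) ∧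
    ∫ x in Set.Ioi (0 : ℝ), (1 - Real.cos (t * x)) * x ^ (-1 - b) =
      oneSubCosConst b * |t| ^ b := by
  obtain ⟨h1, h2⟩ := integrableOn_and_integral_of_lintegral measurableSet_Ioi
    (f := fun x : ℝ => (1 - Real.cos x) * x ^ (-1 - b)) (by fun_prop)
    (fun x hx => mul_nonneg (by linarith [Real.cos_le_one x]) (Real.rpow_nonneg (le_of_lt hx) _))
    (oneSubCosConst_pos hb hb2).le (lintegral_one_sub_cos_mul_rpow hb hb2)
  rcases eq_or_ne t 0 with rfl | ht
  · simp [Real.zero_rpow hb.ne']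
  have ht' : 0 < |t| := abs_pos.2 ht
  have h3 : Set.EqOn (fun x : ℝ => (1 - Real.cos (t * x)) * x ^ (-1 - b))
      (fun x => |t| ^ (1 + b) * ((1 - Real.cos (|t| * x)) * (|t| * x) ^ (-1 - b))) (Set.Ioi 0) := by
    intro x hx
    have hx' : (0 : ℝ) < x := hx
    simp only
    rw [Real.mul_rpow ht'.le hx'.le]
    have e1 : Real.cos (|t| * x) = Real.cos (t * x) := by
      rcases abs_choice t with h | h <;> rw [h]
      rw [neg_mul, Real.cos_neg]
    have e2 : |t| ^ (1 + b) * |t| ^ (-1 - b) = 1 := by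
      rw [← Real.rpow_add ht']; simp
    rw [e1]
    linear_combination -(1 - Real.cos (t * x)) * x ^ (-1 - b) * e2
  constructor
  · rw [integrableOn_congr_fun h3 measurableSet_Ioi]
    refine Integrable.const_mul ?_ _
    have := (integrableOn_Ioi_comp_mul_left_iff
      (fun x : ℝ => (1 - Real.cos x) * x ^ (-1 - b)) 0 ht').2 (by rwa [mul_zero])
    exact this
  · rw [setIntegral_congr_fun measurableSet_Ioi h3, integral_const_mul,
      integral_comp_mul_left_Ioi (fun x : ℝ => (1 - Real.cos x) * x ^ (-1 - b)) 0 ht', mul_zero,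
      h2, smul_eq_mul, Real.rpow_add ht', Real.rpow_one]
    field_simp

/-- The lattice sum `∑_k |λ + 2kπ|^{-2h-1}`. -/
def latSum (h l : ℝ) : ℝ := ∑' k : ℤ, |l + 2 * (k : ℝ) * Real.pi| ^ (-2 * h - 1)

/-- The spectral density without its normalising constant. -/
def specF (h l : ℝ) : ℝ := 2 * (1 - Real.cos l) * latSum h l

/-- The normalising constant `C_h` of the spectral density. -/
def specC (h : ℝ) : ℝ :=
  Real.Gamma (2 * h + 1) * Real.sin (Real.pi * h) / (2 * Real.pi)

lemma fgnSpec_eq (h l : ℝ) : fgnSpec h l = specC h * specF h l := by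
  rw [fgnSpec, specC, specF, latSum]; ring

lemma summable_lat {h : ℝ} (hh : 0 < h) (l : ℝ) :
    Summable fun k : ℤ => |l + 2 * (k : ℝ) * Real.pi| ^ (-2 * h - 1) := by
  have h1 := (Real.summable_one_div_int_add_rpow (l / (2 * Real.pi)) (2 * h + 1)).2 (by linarith)
  refine (h1.mul_left ((2 * Real.pi) ^ (-2 * h - 1))).congr fun k => ?_
  have hpi := Real.pi_pos
  have e : l + 2 * (k : ℝ) * Real.pi = (2 * Real.pi) * (k + l / (2 * Real.pi)) := by field_simp; ring
  rw [e, abs_mul, abs_of_pos (show 0 < 2 * Real.pi by positivity),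
    Real.mul_rpow (by positivity) (abs_nonneg _), one_div, ← Real.rpow_neg (abs_nonneg _)]
  congr 2; ring

lemma latSum_nonneg (h l : ℝ) : 0 ≤ latSum h l :=
  tsum_nonneg fun _ => Real.rpow_nonneg (abs_nonneg _) _

lemma specF_nonneg (h l : ℝ) : 0 ≤ specF h l :=
  mul_nonneg (by linarith [Real.cos_le_one l]) (latSum_nonneg h l)

lemma measurable_latSum {h : ℝ} (hh : 0 < h) : Measurable (latSum h) := by
  have e : latSum h = fun l => (∑' k : ℤ,
      ENNReal.ofReal (|l + 2 * (k : ℝ) * Real.pi| ^ (-2 * h - 1))).toReal := by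
    ext l
    rw [← ENNReal.ofReal_tsum_of_nonneg (fun _ => Real.rpow_nonneg (abs_nonneg _) _)
      (summable_lat hh l)]
    exact (ENNReal.toReal_ofReal (latSum_nonneg h l)).symm
  rw [e]
  exact (Measurable.tsum fun k => by fun_prop).ennreal_toReal

lemma measurable_specF {h : ℝ} (hh : 0 < h) : Measurable (specF h) := by
  have := measurable_latSum hh
  unfold specF
  fun_prop

lemma lintegral_eq_lintegral_circ_tsum {g : ℝ → ENNReal} (hg : Measurable g) :
    ∫⁻ x, g x = ∫⁻ l, ∑' k : ℤ, g (l + 2 * (k : ℝ) * Real.pi) ∂circ := by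
  have hp : 0 < 2 * Real.pi := by positivity
  rw [lintegral_tsum fun k => by fun_prop, ← setLIntegral_univ,
    ← iUnion_Ioc_add_zsmul hp (-Real.pi), lintegral_iUnion (fun _ => measurableSet_Ioc)
      (Set.pairwise_disjoint_Ioc_add_zsmul (-Real.pi) (2 * Real.pi))]
  refine tsum_congr fun k => ?_
  have hmp := measurePreserving_add_right (volume : Measure ℝ) (2 * (k : ℝ) * Real.pi)
  rw [← hmp.setLIntegral_comp_preimage measurableSet_Ioc hg]
  congr 2
  ext x
  simp only [Set.mem_preimage, Set.mem_Ioc, zsmul_eq_mul]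
  push_cast
  constructor <;> rintro ⟨h1, h2⟩ <;> constructor <;> linarith

lemma specC_eq_inv (h : ℝ) (hh : 0 < h) (hh1 : h < 1) :
    specC h * (4 * oneSubCosConst (2 * h)) = 1 := by
  have h1 := sin_pi_mul_half_pos (b := 2 * h) (by linarith) (by linarith)
  have h2 := Real.Gamma_pos_of_pos (show 0 < 1 + 2 * h by linarith)
  have := Real.pi_pos
  rw [show Real.pi * (2 * h) / 2 = Real.pi * h by ring] at h1
  rw [specC, oneSubCosConst, show Real.pi * (2 * h) / 2 = Real.pi * h by ring, add_comm (2 * h)]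
  set S := Real.sin (Real.pi * h)
  field_simp
  norm_num

lemma specC_pos {h : ℝ} (hh : 0 < h) (hh1 : h < 1) : 0 < specC h := by
  have h1 := specC_eq_inv h hh hh1
  have h2 := oneSubCosConst_pos (b := 2 * h) (by linarith) (by linarith)
  by_contra hc
  nlinarith [mul_nonneg (sub_nonneg.2 (not_lt.1 hc)) h2.le]

lemma integral_cos_mul_density {h : ℝ} (hh : 0 < h) (hh1 : h < 1) (m : ℝ) :
    ∫ x, Real.cos (m * x) * (2 * (1 - Real.cos x) * |x| ^ (-2 * h - 1)) =
      4 * oneSubCosConst (2 * h) *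
        ((|m + 1| ^ (2 * h) - 2 * |m| ^ (2 * h) + |m - 1| ^ (2 * h)) / 2) := by
  have e : ∀ x : ℝ, Real.cos (m * x) * (2 * (1 - Real.cos x) * |x| ^ (-2 * h - 1)) =
      (fun y : ℝ => Real.cos (m * y) * (2 * (1 - Real.cos y) * y ^ (-2 * h - 1))) |x| := by
    intro x
    simp only [Real.cos_abs]
    rcases abs_choice x with h | h <;> rw [h]
    rw [mul_neg, Real.cos_neg]
  rw [integral_congr_ae (ae_of_all _ e), integral_comp_abs
    (f := fun y : ℝ => Real.cos (m * y) * (2 * (1 - Real.cos y) * y ^ (-2 * h - 1)))]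
  have key := fun t => integral_one_sub_cos_mul (b := 2 * h) (by linarith) (by linarith) t
  have e2 : ∀ y : ℝ, Real.cos (m * y) * (2 * (1 - Real.cos y) * y ^ (-2 * h - 1)) =
      (1 - Real.cos ((m + 1) * y)) * y ^ (-1 - 2 * h) +
      (1 - Real.cos ((m - 1) * y)) * y ^ (-1 - 2 * h) -
      2 * ((1 - Real.cos (m * y)) * y ^ (-1 - 2 * h)) := by
    intro y
    rw [add_mul, sub_mul m, one_mul, Real.cos_add, Real.cos_sub, show -2 * h - 1 = -1 - 2 * h by ring]
    ring
  simp only [e2]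
  have hadd : IntegrableOn (fun y : ℝ => (1 - Real.cos ((m + 1) * y)) * y ^ (-1 - 2 * h) +
      (1 - Real.cos ((m - 1) * y)) * y ^ (-1 - 2 * h)) (Set.Ioi 0) := (key _).1.add (key _).1
  rw [integral_sub hadd ((key _).1.const_mul 2), integral_add (key _).1 (key _).1, integral_const_mul, (key _).2, (key _).2, (key _).2]
  ring

lemma integrable_density {h : ℝ} (hh : 0 < h) (hh1 : h < 1) :
    Integrable fun x : ℝ => 2 * (1 - Real.cos x) * |x| ^ (-2 * h - 1) := by
  have h1 := integral_cos_mul_density hh hh1 0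
  simp only [zero_mul, Real.cos_zero, one_mul] at h1
  refine Integrable.of_integral_ne_zero ?_
  rw [h1]
  have := oneSubCosConst_pos (b := 2 * h) (by linarith) (by linarith)
  simp only [zero_add, abs_one, Real.one_rpow, abs_zero, zero_sub, abs_neg,
    Real.zero_rpow (show 2 * h ≠ 0 by linarith)]
  norm_num
  exact this.ne'

lemma integrable_and_integral_specF_add {h : ℝ} (hh : 0 < h) (hh1 : h < 1) (m : ℤ) :
    Integrable (fun l => specF h l * (1 + Real.cos (m * l))) circ ∧
    ∫ l, specF h l * (1 + Real.cos (m * l)) ∂circ =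
      ∫ x, 2 * (1 - Real.cos x) * |x| ^ (-2 * h - 1) * (1 + Real.cos (m * x)) := by
  have hc1 : ∀ x : ℝ, 0 ≤ 2 * (1 - Real.cos x) := fun x => by linarith [Real.cos_le_one x]
  have hc2 : ∀ x : ℝ, 0 ≤ 1 + Real.cos (m * x) := fun x => by linarith [Real.neg_one_le_cos (m * x)]
  have hnn : ∀ x : ℝ, 0 ≤ 2 * (1 - Real.cos x) * |x| ^ (-2 * h - 1) * (1 + Real.cos (m * x)) :=
    fun x => mul_nonneg (mul_nonneg (hc1 x) (Real.rpow_nonneg (abs_nonneg _) _)) (hc2 x)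
  have hint : Integrable fun x : ℝ =>
      2 * (1 - Real.cos x) * |x| ^ (-2 * h - 1) * (1 + Real.cos (m * x)) :=
    (integrable_density hh hh1).mul_bdd (c := 2) (by fun_prop) (ae_of_all _ fun x => by
      rw [Real.norm_eq_abs, abs_of_nonneg (hc2 x)]; linarith [Real.cos_le_one (m * x)])
  have hl := lintegral_eq_lintegral_circ_tsum (g := fun x => ENNReal.ofReal
    (2 * (1 - Real.cos x) * |x| ^ (-2 * h - 1) * (1 + Real.cos (m * x)))) (by fun_prop)
  have hterm : ∀ l : ℝ, ∑' k : ℤ, ENNReal.ofReal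
      (2 * (1 - Real.cos (l + 2 * (k : ℝ) * Real.pi)) * |l + 2 * (k : ℝ) * Real.pi| ^ (-2 * h - 1) *
        (1 + Real.cos (m * (l + 2 * (k : ℝ) * Real.pi)))) =
      ENNReal.ofReal (specF h l * (1 + Real.cos (m * l))) := by
    intro l
    have e : ∀ k : ℤ, 2 * (1 - Real.cos (l + 2 * (k : ℝ) * Real.pi)) *
        |l + 2 * (k : ℝ) * Real.pi| ^ (-2 * h - 1) *
        (1 + Real.cos (m * (l + 2 * (k : ℝ) * Real.pi))) =
        (2 * (1 - Real.cos l) * (1 + Real.cos (m * l))) *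
          |l + 2 * (k : ℝ) * Real.pi| ^ (-2 * h - 1) := by
      intro k
      have e1 : Real.cos (l + 2 * (k : ℝ) * Real.pi) = Real.cos l := by
        rw [show 2 * (k : ℝ) * Real.pi = k * (2 * Real.pi) by ring, Real.cos_add_int_mul_two_pi]
      have e2 : Real.cos (m * (l + 2 * (k : ℝ) * Real.pi)) = Real.cos (m * l) := by
        rw [show (m : ℝ) * (l + 2 * (k : ℝ) * Real.pi) = m * l + ((m * k : ℤ) : ℝ) * (2 * Real.pi) by
          push_cast; ring, Real.cos_add_int_mul_two_pi]
      rw [e1, e2]; ring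
    simp only [e]
    rw [← ENNReal.ofReal_tsum_of_nonneg (fun k => mul_nonneg (mul_nonneg (hc1 l) (hc2 l))
      (Real.rpow_nonneg (abs_nonneg _) _)) ((summable_lat hh l).mul_left _), tsum_mul_left]
    congr 1
    rw [specF, latSum]; ring
  simp only [hterm] at hl
  rw [← ofReal_integral_eq_lintegral_ofReal hint (ae_of_all _ hnn)] at hl
  exact integrableOn_and_integral_of_lintegral measurableSet_Ioc
    ((measurable_specF hh).mul (by fun_prop)) (fun l _ => mul_nonneg (specF_nonneg h l) (hc2 l))
    (integral_nonneg hnn) hl.symm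

lemma integrable_specF {h : ℝ} (hh : 0 < h) (hh1 : h < 1) : Integrable (specF h) circ := by
  have := (integrable_and_integral_specF_add hh hh1 0).1.div_const 2
  refine this.congr (ae_of_all _ fun l => ?_)
  simp
  ring

/-- Spectral representation of the covariance matrix of fractional Gaussian noise. -/
lemma fgnT_eq_toep {h : ℝ} (hh : 0 < h) (hh1 : h < 1) (n : ℕ) :
    fgnT n h = specC h • toep (specF h) n := by
  ext i j
  set m : ℤ := (i : ℕ) - (j : ℕ) with hm
  have hm' : (m : ℝ) = ((i : ℕ) : ℝ) - ((j : ℕ) : ℝ) := by rw [hm]; push_cast; rfl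
  have hF := integrable_specF hh hh1
  have hD := integrable_density hh hh1
  have h1 := (integrable_and_integral_specF_add hh hh1 m).2
  have h0 := (integrable_and_integral_specF_add hh hh1 0).2
  have hDc : Integrable fun x : ℝ =>
      2 * (1 - Real.cos x) * |x| ^ (-2 * h - 1) * Real.cos (m * x) :=
    hD.mul_bdd (c := 1) (by fun_prop) (ae_of_all _ fun x => by
      simpa using Real.abs_cos_le_one (m * x))
  simp only [Int.cast_zero, zero_mul, Real.cos_zero, integral_mul_const] at h0
  simp only [mul_add, mul_one] at h1
  rw [integral_add hF (integrable_mul_cos hF _), integral_add hD hDc] at h1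
  have h2 := integral_cos_mul_density hh hh1 m
  have h3 : ∫ x : ℝ, 2 * (1 - Real.cos x) * |x| ^ (-2 * h - 1) * Real.cos (m * x) =
      ∫ x : ℝ, Real.cos (m * x) * (2 * (1 - Real.cos x) * |x| ^ (-2 * h - 1)) := by
    congr 1; ext x; ring
  have h4 : toep (specF h) n i j = 4 * oneSubCosConst (2 * h) *
      ((|(m : ℝ) + 1| ^ (2 * h) - 2 * |(m : ℝ)| ^ (2 * h) + |(m : ℝ) - 1| ^ (2 * h)) / 2) := by
    rw [toep, ← hm', ← h2, ← h3]
    linarith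
  rw [Matrix.smul_apply, smul_eq_mul, h4, ← mul_assoc, specC_eq_inv h hh hh1, one_mul, fgnT, hm']

lemma ae_circ_ne_zero : ∀ᵐ l ∂circ, l ∈ Set.Ioc (-Real.pi) Real.pi ∧ l ≠ 0 := by
  filter_upwards [ae_restrict_mem measurableSet_Ioc,
    ae_restrict_of_ae (Measure.ae_ne volume (0 : ℝ))] with l h1 h2 using ⟨h1, h2⟩

lemma lattice_abs_ge {l : ℝ} (hl : |l| ≤ Real.pi) {k : ℤ} (hk : k ≠ 0) :
    Real.pi * |(k : ℝ)| ≤ |l + 2 * (k : ℝ) * Real.pi| := by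
  have hpi := Real.pi_pos
  have h1 : (1 : ℝ) ≤ |(k : ℝ)| := by exact_mod_cast Int.one_le_abs hk
  have h2 : |2 * (k : ℝ) * Real.pi| = 2 * Real.pi * |(k : ℝ)| := by
    rw [abs_mul, abs_mul, abs_two, abs_of_pos hpi]; ring
  have h3 := abs_sub_abs_le_abs_sub (2 * (k : ℝ) * Real.pi) (-l)
  rw [abs_neg, h2, sub_neg_eq_add, add_comm (2 * (k : ℝ) * Real.pi)] at h3
  nlinarith

lemma lattice_ne_zero {l : ℝ} (hl : |l| ≤ Real.pi) (hl0 : l ≠ 0) (k : ℤ) :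
    l + 2 * (k : ℝ) * Real.pi ≠ 0 := by
  rcases eq_or_ne k 0 with rfl | hk
  · simpa using hl0
  · have h1 : (1 : ℝ) ≤ |(k : ℝ)| := by exact_mod_cast Int.one_le_abs hk
    have := lattice_abs_ge hl hk
    refine abs_pos.1 (lt_of_lt_of_le ?_ this)
    have := Real.pi_pos
    positivity

lemma one_sub_cos_pos {l : ℝ} (hl : |l| ≤ Real.pi) (hl0 : l ≠ 0) : 0 < 1 - Real.cos l := by
  have h1 : Real.cos |l| < Real.cos 0 :=
    Real.cos_lt_cos_of_nonneg_of_le_pi le_rfl hl (abs_pos.2 hl0)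
  rw [Real.cos_abs, Real.cos_zero] at h1
  linarith

lemma latSum_pos {h l : ℝ} (hh : 0 < h) (hl0 : l ≠ 0) : 0 < latSum h l := by
  refine (summable_lat hh l).tsum_pos (fun _ => Real.rpow_nonneg (abs_nonneg _) _) 0 ?_
  simp only [Int.cast_zero, mul_zero, zero_mul, add_zero]
  exact Real.rpow_pos_of_pos (abs_pos.2 hl0) _

lemma specF_pos {h l : ℝ} (hh : 0 < h) (hl : |l| ≤ Real.pi) (hl0 : l ≠ 0) : 0 < specF h l := by
  have h1 := one_sub_cos_pos hl hl0
  have h2 := latSum_pos hh hl0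
  unfold specF
  positivity

lemma ae_specF_pos {h : ℝ} (hh : 0 < h) : ∀ᵐ l ∂circ, 0 < specF h l := by
  filter_upwards [ae_circ_ne_zero] with l hl
  exact specF_pos hh (abs_le.2 ⟨hl.1.1.le, hl.1.2⟩) hl.2

lemma latSum_neg (h l : ℝ) : latSum h (-l) = latSum h l := by
  rw [latSum, latSum, ← (Equiv.neg ℤ).tsum_eq]
  refine tsum_congr fun k => ?_
  rw [Equiv.neg_apply, ← abs_neg]
  congr 2
  push_cast; ring

lemma specF_abs (h l : ℝ) : specF h |l| = specF h l := by
  rcases abs_choice l with e | e <;> rw [e]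
  rw [specF, specF, latSum_neg, Real.cos_neg]

/-- The lattice sum without its central term. -/
def latRest (h l : ℝ) : ℝ :=
  ∑' k : ℤ, if k = 0 then 0 else |l + 2 * (k : ℝ) * Real.pi| ^ (-2 * h - 1)

lemma continuousOn_latRest {h : ℝ} (hh : 0 < h) :
    ContinuousOn (latRest h) (Set.Icc 0 Real.pi) := by
  have hpi := Real.pi_pos
  have hu : Summable fun k : ℤ => Real.pi ^ (-2 * h - 1) * (1 / |(k : ℝ) + 0| ^ (2 * h + 1)) :=
    ((Real.summable_one_div_int_add_rpow 0 (2 * h + 1)).2 (by linarith)).mul_left _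
  have habs : ∀ x ∈ Set.Icc 0 Real.pi, |x| ≤ Real.pi := fun x hx => by
    rw [abs_of_nonneg hx.1]; exact hx.2
  refine continuousOn_tsum (fun k => ?_) hu fun k x hx => ?_
  · split_ifs with hk
    · exact continuousOn_const
    · refine ContinuousOn.rpow_const (by fun_prop) fun x hx => Or.inl ?_
      have h1 : (1 : ℝ) ≤ |(k : ℝ)| := by exact_mod_cast Int.one_le_abs hk
      have := lattice_abs_ge (habs x hx) hk
      exact (lt_of_lt_of_le (by positivity) this).ne'
  · split_ifs with hk
    · rw [norm_zero]; positivity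
    · have h1 : (1 : ℝ) ≤ |(k : ℝ)| := by exact_mod_cast Int.one_le_abs hk
      have h2 := lattice_abs_ge (habs x hx) hk
      rw [Real.norm_eq_abs, abs_of_nonneg (Real.rpow_nonneg (abs_nonneg _) _), add_zero, one_div,
        ← Real.rpow_neg (abs_nonneg _), show -(2 * h + 1) = -2 * h - 1 by ring,
        ← Real.mul_rpow hpi.le (abs_nonneg _)]
      exact Real.rpow_le_rpow_of_nonpos (by positivity) h2 (by linarith)

lemma latRest_nonneg (h l : ℝ) : 0 ≤ latRest h l :=
  tsum_nonneg fun k => by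
    split_ifs
    · exact le_rfl
    · exact Real.rpow_nonneg (abs_nonneg _) _

lemma latSum_eq {h : ℝ} (hh : 0 < h) (l : ℝ) :
    latSum h l = |l| ^ (-2 * h - 1) + latRest h l := by
  rw [latSum, (summable_lat hh l).tsum_eq_add_tsum_ite 0, latRest]
  simp

/-- The regular factor of the spectral density: `F_h(λ) = |λ|^{1-2h} specReg h |λ|`. -/
def specReg (h x : ℝ) : ℝ := Real.sinc (x / 2) ^ 2 * (1 + x ^ (2 * h + 1) * latRest h x)

lemma continuousOn_specReg {h : ℝ} (hh : 0 < h) :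
    ContinuousOn (specReg h) (Set.Icc 0 Real.pi) := by
  have h1 := continuousOn_latRest hh
  have h2 : ContinuousOn (fun x : ℝ => x ^ (2 * h + 1)) (Set.Icc 0 Real.pi) :=
    ContinuousOn.rpow_const continuousOn_id fun x _ => Or.inr (by linarith)
  have h3 : Continuous fun x : ℝ => Real.sinc (x / 2) ^ 2 :=
    (Real.continuous_sinc.comp (by fun_prop)).pow 2
  exact h3.continuousOn.mul (continuousOn_const.add (h2.mul h1))

lemma specReg_pos (h : ℝ) {x : ℝ} (hx : x ∈ Set.Icc 0 Real.pi) : 0 < specReg h x := by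
  have hpi := Real.pi_pos
  have h1 : 0 < Real.sinc (x / 2) := by
    rcases hx.1.eq_or_lt with rfl | h0
    · simp
    · rw [Real.sinc_of_ne_zero (by positivity)]
      have := Real.sin_pos_of_pos_of_lt_pi (x := x / 2) (by positivity) (by linarith [hx.2])
      positivity
  have h2 : 0 ≤ x ^ (2 * h + 1) * latRest h x :=
    mul_nonneg (Real.rpow_nonneg hx.1 _) (latRest_nonneg h x)
  unfold specReg
  positivity

lemma specF_eq_rpow_mul {h x : ℝ} (hh : 0 < h) (hx : 0 < x) :
    specF h x = x ^ (1 - 2 * h) * specReg h x := by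
  have e1 : 2 * (1 - Real.cos x) = x ^ 2 * Real.sinc (x / 2) ^ 2 := by
    rw [Real.sinc_of_ne_zero (by positivity), div_pow, Real.sin_sq_eq_half_sub,
      show 2 * (x / 2) = x by ring]
    field_simp
  have e2 : x ^ (1 - 2 * h) = x ^ 2 * x ^ (-2 * h - 1) := by
    rw [← Real.rpow_natCast, ← Real.rpow_add hx]; congr 1; push_cast; ring
  have e3 : x ^ (-2 * h - 1) * x ^ (2 * h + 1) = 1 := by
    rw [← Real.rpow_add hx, show -2 * h - 1 + (2 * h + 1) = 0 by ring, Real.rpow_zero]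
  rw [specF, e1, latSum_eq hh, abs_of_pos hx, specReg, e2]
  linear_combination -(x ^ 2 * Real.sinc (x / 2) ^ 2 * latRest h x) * e3

lemma integrable_abs_rpow {p : ℝ} (hp : -1 < p) : Integrable (fun l : ℝ => |l| ^ p) circ := by
  have hpi := Real.pi_pos
  have h0 : IntegrableOn (fun x : ℝ => |x| ^ p) (Set.Icc 0 Real.pi) := by
    have h := intervalIntegral.intervalIntegrable_rpow' (a := 0) (b := Real.pi) hp
    rw [intervalIntegrable_iff_integrableOn_Icc_of_le hpi.le] at h
    refine h.congr_fun (fun x hx => ?_) measurableSet_Icc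
    simp only
    rw [abs_of_nonneg hx.1]
  have h1 : IntegrableOn (fun x : ℝ => |x| ^ p) (Set.Icc (-Real.pi) 0) := by
    have := ((Measure.measurePreserving_neg (volume : Measure ℝ)).integrableOn_comp_preimage
      (MeasurableEquiv.neg ℝ).measurableEmbedding).2 h0
    have e : (Neg.neg ⁻¹' Set.Icc (0 : ℝ) Real.pi) = Set.Icc (-Real.pi) 0 := by
      ext x; simp only [Set.mem_preimage, Set.mem_Icc]
      constructor <;> rintro ⟨h1, h2⟩ <;> constructor <;> linarith
    rw [e] at this
    simpa [Function.comp_def] using this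
  have h2 := h1.union h0
  rw [Set.Icc_union_Icc_eq_Icc (by linarith) hpi.le] at h2
  exact h2.mono_set Set.Ioc_subset_Icc_self

lemma integrable_abs_rpow_mul {p : ℝ} (hp : -1 < p) {β : ℝ → ℝ}
    (hβ : ContinuousOn β (Set.Icc 0 Real.pi)) :
    Integrable (fun l : ℝ => |l| ^ p * β |l|) circ := by
  obtain ⟨C, hC⟩ := isCompact_Icc.exists_bound_of_continuousOn hβ
  have hm : ∀ l ∈ Set.Ioc (-Real.pi) Real.pi, |l| ∈ Set.Icc 0 Real.pi := fun l hl =>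
    ⟨abs_nonneg l, abs_le.2 ⟨hl.1.le, hl.2⟩⟩
  refine (integrable_abs_rpow hp).mul_bdd (c := C) ?_ ?_
  · exact (hβ.comp continuous_abs.continuousOn hm).aestronglyMeasurable measurableSet_Ioc
  · filter_upwards [ae_restrict_mem measurableSet_Ioc] with l hl using hC _ (hm l hl)

lemma ae_specF_eq {h : ℝ} (hh : 0 < h) :
    ∀ᵐ l ∂circ, |l| ∈ Set.Ioc 0 Real.pi ∧ specF h l = |l| ^ (1 - 2 * h) * specReg h |l| := by
  filter_upwards [ae_circ_ne_zero] with l hl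
  have h1 := abs_pos.2 hl.2
  exact ⟨⟨h1, abs_le.2 ⟨hl.1.1.le, hl.1.2⟩⟩, by rw [← specF_abs, specF_eq_rpow_mul hh h1]⟩

lemma continuousOn_specReg_inv {h : ℝ} (hh : 0 < h) :
    ContinuousOn (fun x => (specReg h x)⁻¹) (Set.Icc 0 Real.pi) :=
  (continuousOn_specReg hh).inv₀ fun _ hx => (specReg_pos h hx).ne'

lemma integrable_specF_inv {h : ℝ} (hh : 0 < h) :
    Integrable (fun l => (specF h l)⁻¹) circ := by
  refine (integrable_abs_rpow_mul (p := 2 * h - 1) (by linarith)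
    (continuousOn_specReg_inv hh)).congr ?_
  filter_upwards [ae_specF_eq hh] with l hl
  rw [hl.2, mul_inv, ← Real.rpow_neg (abs_nonneg _), neg_sub]

lemma integrable_specF_inv_mul {h h' : ℝ} (hh : 0 < h) (hh' : 0 < h') (hd : h' - h < 1 / 2) :
    Integrable (fun l => (specF h l)⁻¹ * specF h' l) circ := by
  refine (integrable_abs_rpow_mul (p := 2 * h - 2 * h') (by linarith)
    ((continuousOn_specReg_inv hh).mul (continuousOn_specReg hh'))).congr ?_
  filter_upwards [ae_specF_eq hh, ae_specF_eq hh'] with l hl hl'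
  rw [hl.2, hl'.2, mul_inv, ← Real.rpow_neg (abs_nonneg _), neg_sub,
    show 2 * h - 2 * h' = (2 * h - 1) + (1 - 2 * h') by ring, Real.rpow_add hl.1.1,
    Pi.mul_apply]
  ring

lemma PairLim.symm {a b : ℝ → ℝ} (h : PairLim a b) : PairLim b a := by
  unfold PairLim at h ⊢
  simp only [toepPair_comm b a, mul_comm (b _)]
  exact h

lemma pairLim_specF {h h' : ℝ} (hh : 0 < h) (hh' : 0 < h') (hh1 : h' < 1)
    (hcase : h < 1 / 2 → h' < 1 / 2) : PairLim (fun l => (specF h l)⁻¹) (specF h') := by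
  have hF := integrable_specF hh' hh1
  have hFi := integrable_specF_inv hh
  by_cases hc : h < 1 / 2
  · refine pairLim_of_continuousOn (β := fun x => x ^ (1 - 2 * h') * specReg h' x) hFi
      (ae_of_all _ fun l => inv_nonneg.2 (specF_nonneg h l)) ?_ ?_ hF
    · refine ContinuousOn.mul (ContinuousOn.rpow_const continuousOn_id fun x _ => Or.inr ?_)
        (continuousOn_specReg hh')
      linarith [hcase hc]
    · filter_upwards [ae_specF_eq hh'] with l hl using hl.2
  · refine PairLim.symm (pairLim_of_continuousOn
      (β := fun x => x ^ (2 * h - 1) * (specReg h x)⁻¹) hF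
      (ae_of_all _ fun l => specF_nonneg h' l) ?_ ?_ hFi)
    · refine ContinuousOn.mul (ContinuousOn.rpow_const continuousOn_id fun x _ => Or.inr ?_)
        (continuousOn_specReg_inv hh)
      linarith [not_lt.1 hc]
    · filter_upwards [ae_specF_eq hh] with l hl
      rw [hl.2, mul_inv, ← Real.rpow_neg (abs_nonneg _), neg_sub]

lemma rpow_le_rpow_add_rpow {x p q r : ℝ} (hx : 0 < x) (hpq : p ≤ q) (hqr : q ≤ r) :
    x ^ q ≤ x ^ p + x ^ r := by
  have hp := Real.rpow_nonneg hx.le p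
  have hr := Real.rpow_nonneg hx.le r
  rcases le_total 1 x with h1 | h1
  · linarith [Real.rpow_le_rpow_of_exponent_le h1 hqr]
  · linarith [Real.rpow_le_rpow_of_exponent_ge hx h1 hpq]

lemma abs_log_le_rpow_add_rpow {x δ : ℝ} (hx : 0 < x) (hδ : 0 < δ) :
    |Real.log x| ≤ (x ^ δ + x ^ (-δ)) / δ := by
  have h1 := Real.log_le_rpow_div hx.le hδ
  have h2 := Real.log_le_rpow_div (inv_pos.2 hx).le hδ
  rw [Real.log_inv, Real.inv_rpow hx.le, ← Real.rpow_neg hx.le] at h2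
  have h3 : 0 ≤ x ^ δ / δ := by positivity
  have h4 : 0 ≤ x ^ (-δ) / δ := by positivity
  rw [add_div, abs_le]
  constructor <;> linarith

lemma abs_log_mul_rpow_le {x H h η : ℝ} (hx : 0 < x) (hη : 0 < η) (hh : |h - H| ≤ η) :
    |-2 * Real.log x * x ^ (-2 * h - 1)| ≤
      2 / η * (x ^ (-2 * (H - 2 * η) - 1) + x ^ (-2 * (H + 2 * η) - 1)) := by
  obtain ⟨h1, h2⟩ := abs_le.1 hh
  have hl := abs_log_le_rpow_add_rpow hx (δ := 2 * η) (by positivity)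
  have e1 : x ^ (2 * η) * x ^ (-2 * h - 1) ≤
      x ^ (-2 * (H - 2 * η) - 1) + x ^ (-2 * (H + 2 * η) - 1) := by
    rw [← Real.rpow_add hx, add_comm (x ^ (-2 * (H - 2 * η) - 1))]
    exact rpow_le_rpow_add_rpow hx (by linarith) (by linarith)
  have e2 : x ^ (-(2 * η)) * x ^ (-2 * h - 1) ≤
      x ^ (-2 * (H - 2 * η) - 1) + x ^ (-2 * (H + 2 * η) - 1) := by
    rw [← Real.rpow_add hx, add_comm (x ^ (-2 * (H - 2 * η) - 1))]
    exact rpow_le_rpow_add_rpow hx (by linarith) (by linarith)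
  have hp := Real.rpow_nonneg hx.le (-2 * h - 1)
  rw [abs_mul, abs_mul, abs_of_nonneg hp, abs_neg, abs_two]
  calc 2 * |Real.log x| * x ^ (-2 * h - 1)
      ≤ 2 * ((x ^ (2 * η) + x ^ (-(2 * η))) / (2 * η)) * x ^ (-2 * h - 1) := by gcongr
    _ = 1 / η * (x ^ (2 * η) * x ^ (-2 * h - 1) + x ^ (-(2 * η)) * x ^ (-2 * h - 1)) := by
        field_simp
    _ ≤ 1 / η * ((x ^ (-2 * (H - 2 * η) - 1) + x ^ (-2 * (H + 2 * η) - 1)) +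
          (x ^ (-2 * (H - 2 * η) - 1) + x ^ (-2 * (H + 2 * η) - 1))) := by gcongr
    _ = _ := by ring

/-- The termwise derivative of `latSum` in the Hurst parameter. -/
def dlatSum (h l : ℝ) : ℝ :=
  ∑' k : ℤ, -2 * Real.log |l + 2 * (k : ℝ) * Real.pi| * |l + 2 * (k : ℝ) * Real.pi| ^ (-2 * h - 1)

lemma summable_lat_bound {H η : ℝ} (hη : 0 < η) (hH : 2 * η < H) (l : ℝ) :
    Summable fun k : ℤ => 2 / η * (|l + 2 * (k : ℝ) * Real.pi| ^ (-2 * (H - 2 * η) - 1) +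
      |l + 2 * (k : ℝ) * Real.pi| ^ (-2 * (H + 2 * η) - 1)) :=
  ((summable_lat (by linarith) l).add (summable_lat (by linarith) l)).mul_left _

lemma hasDerivAt_latSum {H η h l : ℝ} (hη : 0 < η) (hH : 2 * η < H) (hh : |h - H| < η)
    (hl : |l| ≤ Real.pi) (hl0 : l ≠ 0) : HasDerivAt (fun y => latSum y l) (dlatSum h l) h := by
  have hx : ∀ k : ℤ, 0 < |l + 2 * (k : ℝ) * Real.pi| := fun k =>
    abs_pos.2 (lattice_ne_zero hl hl0 k)
  unfold latSum dlatSum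
  refine hasDerivAt_tsum_of_isPreconnected (t := Metric.ball H η) (y₀ := H)
    (g := fun (k : ℤ) y => |l + 2 * (k : ℝ) * Real.pi| ^ (-2 * y - 1))
    (g' := fun (k : ℤ) y => -2 * Real.log |l + 2 * (k : ℝ) * Real.pi| *
      |l + 2 * (k : ℝ) * Real.pi| ^ (-2 * y - 1))
    (summable_lat_bound hη hH l)
    Metric.isOpen_ball (convex_ball H η).isPreconnected (fun k y _ => ?_) (fun k y hy => ?_)
    (Metric.mem_ball_self hη) (summable_lat (by linarith) l) (by rwa [Metric.mem_ball, Real.dist_eq])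
  · have h1 : HasDerivAt (fun y : ℝ => -2 * y - 1) (-2) y := by
      simpa using ((hasDerivAt_id y).const_mul (-2)).sub_const 1
    have h2 := h1.const_rpow (hx k)
    rwa [mul_comm (Real.log _)] at h2
  · rw [Metric.mem_ball, Real.dist_eq] at hy
    exact abs_log_mul_rpow_le (hx k) hη hy.le

lemma summable_dlat {H η h l : ℝ} (hη : 0 < η) (hH : 2 * η < H) (hh : |h - H| < η)
    (hl : |l| ≤ Real.pi) (hl0 : l ≠ 0) :
    Summable fun k : ℤ =>
      |-2 * Real.log |l + 2 * (k : ℝ) * Real.pi| *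
        |l + 2 * (k : ℝ) * Real.pi| ^ (-2 * h - 1)| :=
  (summable_lat_bound hη hH l).of_nonneg_of_le (fun _ => abs_nonneg _) fun k =>
    abs_log_mul_rpow_le (abs_pos.2 (lattice_ne_zero hl hl0 k)) hη hh.le

lemma abs_dlatSum_le {H η h l : ℝ} (hη : 0 < η) (hH : 2 * η < H) (hh : |h - H| < η)
    (hl : |l| ≤ Real.pi) (hl0 : l ≠ 0) :
    |dlatSum h l| ≤ 2 / η * (latSum (H - 2 * η) l + latSum (H + 2 * η) l) := by
  have hs := summable_dlat hη hH hh hl hl0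
  have h1 := norm_tsum_le_tsum_norm (f := fun k : ℤ =>
    -2 * Real.log |l + 2 * (k : ℝ) * Real.pi| * |l + 2 * (k : ℝ) * Real.pi| ^ (-2 * h - 1)) hs
  have h2 := hs.tsum_le_tsum (fun k =>
    abs_log_mul_rpow_le (abs_pos.2 (lattice_ne_zero hl hl0 k)) hη hh.le)
    (summable_lat_bound hη hH l)
  rw [tsum_mul_left, (summable_lat (by linarith) l).tsum_add (summable_lat (by linarith) l)] at h2
  simp only [← Real.norm_eq_abs] at h1 h2 ⊢
  exact h1.trans h2

/-- The derivative of `specF` in the Hurst parameter. -/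
def dspecF (h l : ℝ) : ℝ := 2 * (1 - Real.cos l) * dlatSum h l

lemma hasDerivAt_specF {h l : ℝ} (hh : 0 < h) (hl : |l| ≤ Real.pi) (hl0 : l ≠ 0) :
    HasDerivAt (fun y => specF y l) (dspecF h l) h :=
  (hasDerivAt_latSum (H := h) (η := h / 4) (by positivity) (by linarith)
    (by rw [sub_self, abs_zero]; positivity) hl hl0).const_mul _

lemma abs_dspecF_le {H η h l : ℝ} (hη : 0 < η) (hH : 2 * η < H) (hh : |h - H| < η)
    (hl : |l| ≤ Real.pi) (hl0 : l ≠ 0) :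
    |dspecF h l| ≤ 2 / η * (specF (H - 2 * η) l + specF (H + 2 * η) l) := by
  have h0 : 0 ≤ 2 * (1 - Real.cos l) := by linarith [Real.cos_le_one l]
  rw [dspecF, abs_mul, abs_of_nonneg h0]
  refine (mul_le_mul_of_nonneg_left (abs_dlatSum_le hη hH hh hl hl0) h0).trans_eq ?_
  unfold specF
  ring

lemma aestronglyMeasurable_dspecF {h : ℝ} (hh : 0 < h) : AEStronglyMeasurable (dspecF h) circ := by
  have h1 : AEStronglyMeasurable (dlatSum h) circ := by
    refine aestronglyMeasurable_of_tendsto_ae atTop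
      (f := fun (s : Finset ℤ) l => ∑ k ∈ s, -2 * Real.log |l + 2 * (k : ℝ) * Real.pi| *
        |l + 2 * (k : ℝ) * Real.pi| ^ (-2 * h - 1)) (fun s => ?_) ?_
    · exact (Finset.measurable_fun_sum s fun k _ => by fun_prop).aestronglyMeasurable
    · filter_upwards [ae_circ_ne_zero] with l hl
      have hs := summable_dlat (H := h) (η := h / 4) (h := h) (l := l) (by positivity)
        (by linarith) (by rw [sub_self, abs_zero]; positivity) (abs_le.2 ⟨hl.1.1.le, hl.1.2⟩) hl.2
      exact hs.of_abs.hasSum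
  unfold dspecF
  exact (by fun_prop : Continuous fun l : ℝ => 2 * (1 - Real.cos l)).aestronglyMeasurable.mul h1

/-- The limiting normalised trace of `T_n(H)⁻¹ T_n(h)`, up to the constants `specC`. -/
def traceLim (H h : ℝ) : ℝ := 1 / (2 * Real.pi) * ∫ l, (specF H l)⁻¹ * specF h l ∂circ

lemma traceLim_self {H : ℝ} (hH : 0 < H) : traceLim H H = 1 := by
  have h1 : ∫ l, (specF H l)⁻¹ * specF H l ∂circ = ∫ _, (1 : ℝ) ∂circ := by
    refine integral_congr_ae ?_
    filter_upwards [ae_specF_pos hH] with l hl using inv_mul_cancel₀ hl.ne'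
  have hpi := Real.pi_pos
  rw [traceLim, h1, integral_const, measureReal_restrict_apply_univ,
    Real.volume_real_Ioc_of_le (by linarith), smul_eq_mul]
  field_simp
  ring

lemma hasDerivAt_traceLim {H : ℝ} (hH : 0 < H) :
    Integrable (fun l => (specF H l)⁻¹ * dspecF H l) circ ∧
    HasDerivAt (traceLim H) (1 / (2 * Real.pi) * ∫ l, (specF H l)⁻¹ * dspecF H l ∂circ) H := by
  obtain ⟨η, hη, hηH, hη1⟩ : ∃ η : ℝ, 0 < η ∧ 2 * η < H ∧ 2 * η < 1 / 2 := by
    refine ⟨min (H / 4) (1 / 8), by positivity, ?_, ?_⟩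
    · linarith [min_le_left (H / 4) (1 / 8 : ℝ)]
    · linarith [min_le_right (H / 4) (1 / 8 : ℝ)]
  have hpos : ∀ y ∈ Metric.ball H η, 0 < y := fun y hy => by
    rw [Metric.mem_ball, Real.dist_eq] at hy
    linarith [(abs_lt.1 hy).1]
  have hinv := (measurable_specF hH).inv
  have key := hasDerivAt_integral_of_dominated_loc_of_deriv_le (μ := circ) (x₀ := H)
    (s := Metric.ball H η) (F := fun h l => (specF H l)⁻¹ * specF h l)
    (F' := fun h l => (specF H l)⁻¹ * dspecF h l)
    (bound := fun l => 2 / η * ((specF H l)⁻¹ * specF (H - 2 * η) l +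
      (specF H l)⁻¹ * specF (H + 2 * η) l))
    (Metric.ball_mem_nhds H hη) ?_ (integrable_specF_inv_mul hH hH (by norm_num))
    (hinv.aestronglyMeasurable.mul (aestronglyMeasurable_dspecF hH)) ?_ ?_ ?_
  · exact ⟨key.1, key.2.const_mul _⟩
  · filter_upwards [Metric.ball_mem_nhds H hη] with y hy
    exact (hinv.mul (measurable_specF (hpos y hy))).aestronglyMeasurable
  · filter_upwards [ae_circ_ne_zero] with l hl y hy
    rw [Metric.mem_ball, Real.dist_eq] at hy
    have h1 := abs_dspecF_le hη hηH hy (abs_le.2 ⟨hl.1.1.le, hl.1.2⟩) hl.2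
    have h2 := inv_nonneg.2 (specF_nonneg H l)
    rw [Real.norm_eq_abs, abs_mul, abs_of_nonneg h2]
    refine (mul_le_mul_of_nonneg_left h1 h2).trans_eq ?_
    ring
  · exact ((integrable_specF_inv_mul hH (by linarith) (by linarith)).add
      (integrable_specF_inv_mul hH (by linarith) (by linarith))).const_mul _
  · filter_upwards [ae_circ_ne_zero] with l hl y hy
    exact (hasDerivAt_specF (hpos y hy) (abs_le.2 ⟨hl.1.1.le, hl.1.2⟩) hl.2).const_mul _

lemma differentiableAt_specC {h : ℝ} (hh : 0 < h) : DifferentiableAt ℝ specC h := by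
  have h1 : DifferentiableAt ℝ (fun y : ℝ => Real.Gamma (2 * y + 1)) h := by
    refine DifferentiableAt.comp (g := Real.Gamma) (f := fun y : ℝ => 2 * y + 1) h
      (Real.differentiableAt_Gamma fun m => ?_) (by fun_prop)
    have : (0 : ℝ) ≤ m := m.cast_nonneg
    linarith
  unfold specC
  fun_prop

lemma jH_eq {H : ℝ} (hH : 0 < H) (hH1 : H < 1) :
    jH H = -(deriv specC H / specC H + deriv (traceLim H) H) := by
  have hpi := Real.pi_pos
  obtain ⟨hint, hder⟩ := hasDerivAt_traceLim hH
  have hC := specC_pos hH hH1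
  have h1 : ∫ l, dlogSpec H l ∂circ =
      ∫ l, (deriv specC H / specC H + (specF H l)⁻¹ * dspecF H l) ∂circ := by
    refine integral_congr_ae ?_
    filter_upwards [ae_circ_ne_zero] with l hl
    have hl' := abs_le.2 ⟨hl.1.1.le, hl.1.2⟩
    have hF := specF_pos hH hl' hl.2
    have hd := ((differentiableAt_specC hH).hasDerivAt.mul (hasDerivAt_specF hH hl' hl.2)).log
      (mul_pos hC hF).ne'
    have e : (fun h : ℝ => Real.log (fgnSpec h l)) =
        fun y => Real.log ((specC * fun y => specF y l) y) := by
      ext y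
      rw [fgnSpec_eq]; rfl
    rw [dlogSpec, e, hd.deriv]
    simp only [Pi.mul_apply]
    field_simp
  rw [jH, hder.deriv, intervalIntegral.integral_of_le (by linarith), h1,
    integral_add (integrable_const _) hint, integral_const, measureReal_restrict_apply_univ,
    Real.volume_real_Ioc_of_le (by linarith), smul_eq_mul]
  field_simp
  ring

lemma specF_le_of_forall {h h₁ h₂ a b l : ℝ} (hh : 0 < h) (hh₁ : 0 < h₁) (hh₂ : 0 < h₂)
    (hle : ∀ x : ℝ, 0 < x → x ^ (-2 * h - 1) ≤ a * x ^ (-2 * h₁ - 1) + b * x ^ (-2 * h₂ - 1))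
    (hl : |l| ≤ Real.pi) (hl0 : l ≠ 0) : specF h l ≤ a * specF h₁ l + b * specF h₂ l := by
  have h0 : 0 ≤ 2 * (1 - Real.cos l) := by linarith [Real.cos_le_one l]
  have h1 : latSum h l ≤ a * latSum h₁ l + b * latSum h₂ l := by
    have hs₁ := (summable_lat hh₁ l).mul_left a
    have hs₂ := (summable_lat hh₂ l).mul_left b
    have := (summable_lat hh l).tsum_le_tsum
      (fun k : ℤ => hle _ (abs_pos.2 (lattice_ne_zero hl hl0 k))) (hs₁.add hs₂)
    rwa [hs₁.tsum_add hs₂, tsum_mul_left, tsum_mul_left] at this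
  have := mul_le_mul_of_nonneg_left h1 h0
  unfold specF
  linarith

lemma specF_convex_combination_le {a b h₁ h₂ l : ℝ} (ha : 0 ≤ a) (hb : 0 ≤ b) (hab : a + b = 1)
    (hh₁ : 0 < h₁) (hh₂ : 0 < h₂) (hl : |l| ≤ Real.pi) (hl0 : l ≠ 0) :
    specF (a * h₁ + b * h₂) l ≤ a * specF h₁ l + b * specF h₂ l := by
  have hh : 0 < a * h₁ + b * h₂ := (convex_Ioi (0 : ℝ)) hh₁ hh₂ ha hb hab
  refine specF_le_of_forall hh hh₁ hh₂ (fun x hx => ?_) hl hl0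
  have := Real.geom_mean_le_arith_mean2_weighted ha hb (Real.rpow_nonneg hx.le (-2 * h₁ - 1))
    (Real.rpow_nonneg hx.le (-2 * h₂ - 1)) hab
  rw [← Real.rpow_mul hx.le, ← Real.rpow_mul hx.le, ← Real.rpow_add hx] at this
  convert this using 2
  linear_combination hab

lemma specF_add_le {h t ε l : ℝ} (hε : 0 < ε) (hh : 0 < h) (hh₂ : 0 < h + 2 * t)
    (hl : |l| ≤ Real.pi) (hl0 : l ≠ 0) :
    specF (h + t) l ≤ 1 / (4 * ε) * specF h l + ε * specF (h + 2 * t) l := by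
  refine specF_le_of_forall (by linarith) hh hh₂ (fun x hx => ?_) hl hl0
  set u := x ^ ((-2 * h - 1) / 2) with hu
  set v := x ^ ((-2 * (h + 2 * t) - 1) / 2) with hv
  have e1 : x ^ (-2 * (h + t) - 1) = u * v := by
    rw [hu, hv, ← Real.rpow_add hx]; congr 1; ring
  have e2 : x ^ (-2 * h - 1) = u * u := by rw [hu, ← Real.rpow_add hx]; congr 1; ring
  have e3 : x ^ (-2 * (h + 2 * t) - 1) = v * v := by rw [hv, ← Real.rpow_add hx]; congr 1; ring
  rw [e1, e2, e3, ← sub_nonneg]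
  have : 1 / (4 * ε) * (u * u) + ε * (v * v) - u * v = (u - 2 * ε * v) ^ 2 / (4 * ε) := by
    field_simp
    ring
  rw [this]
  positivity

lemma tendsto_mean_and_sum_sq_of_convex_bounds {H δ g : ℝ} {G : ℝ → ℝ} {lam : ∀ n : ℕ, Fin n → ℝ}
    {q : ∀ n : ℕ, Fin n → ℝ → ℝ} {S : ℝ → ℕ → ℝ} (hδ : 0 < δ)
    (hG : HasDerivAt G g H) (hG1 : G H = 1)
    (hq0 : ∀ n i t, |t| < δ → 0 ≤ q n i (H + t))
    (htan : ∀ n i t, |t| < δ → 1 + t * lam n i ≤ q n i (H + t))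
    (hinterp : ∀ n i t ε, 0 < ε → |2 * t| < δ →
      q n i (H + t) ≤ 1 / (4 * ε) + ε * q n i (H + 2 * t))
    (hsum : ∀ n t, |t| < δ → ∑ i, q n i (H + t) ≤ S t n)
    (hS : ∀ t, |t| < δ → Tendsto (fun n : ℕ => S t n / n) atTop (𝓝 (G (H + t)))) :
    Tendsto (fun n : ℕ => (∑ i, lam n i) / n) atTop (𝓝 g) ∧
      Tendsto (fun n : ℕ => (∑ i, lam n i ^ 2) / (n : ℝ) ^ 2) atTop (𝓝 0) := by
  constructor
  · have hbound : ∀ t, |t| < δ → ∀ n : ℕ, 0 < n → t * ((∑ i, lam n i) / n) ≤ S t n / n - 1 := by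
      intro t ht n hn
      have hn' : (0 : ℝ) < n := by exact_mod_cast hn
      have h1 : (n : ℝ) + t * ∑ i, lam n i ≤ S t n := by
        refine le_trans ?_ (hsum n t ht)
        have := Finset.sum_le_sum fun i (_ : i ∈ Finset.univ) => htan n i t ht
        rwa [Finset.sum_add_distrib, ← Finset.mul_sum, Finset.sum_const, Finset.card_univ,
          Fintype.card_fin, nsmul_eq_mul, mul_one] at this
      rw [le_sub_iff_add_le, le_div_iff₀ hn']
      field_simp
      linarith
    have hslope := hG.tendsto_slope_zero
    simp only [smul_eq_mul, hG1] at hslope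
    have hnear : ∀ᶠ t in 𝓝 (0 : ℝ), |t| < δ := by
      filter_upwards [Metric.ball_mem_nhds (0 : ℝ) hδ] with t ht
      simpa [Real.dist_eq] using ht
    refine tendsto_order.2 ⟨fun a ha => ?_, fun a ha => ?_⟩
    · have hleft := hslope.mono_left
        (nhdsWithin_mono (0 : ℝ) fun x (hx : x ∈ Set.Iio (0 : ℝ)) => ne_of_lt hx)
      obtain ⟨t, ⟨h1, h2⟩, h3⟩ := (((hleft.eventually_const_lt ha).and
        (hnear.filter_mono nhdsWithin_le_nhds)).and
        (self_mem_nhdsWithin : Set.Iio (0 : ℝ) ∈ 𝓝[<] (0 : ℝ))).exists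
      have h3 : t < 0 := h3
      have h4 := ((hS t h2).sub_const 1).const_mul t⁻¹
      filter_upwards [h4.eventually_const_lt h1, eventually_gt_atTop 0] with n h5 hn
      refine h5.trans_le ?_
      have := mul_le_mul_of_nonpos_left (hbound t h2 n hn) (inv_lt_zero.2 h3).le
      rwa [inv_mul_cancel_left₀ h3.ne] at this
    · have hright := hslope.mono_left
        (nhdsWithin_mono (0 : ℝ) fun x (hx : x ∈ Set.Ioi (0 : ℝ)) => ne_of_gt hx)
      obtain ⟨t, ⟨h1, h2⟩, h3⟩ := (((hright.eventually_lt_const ha).and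
        (hnear.filter_mono nhdsWithin_le_nhds)).and
        (self_mem_nhdsWithin : Set.Ioi (0 : ℝ) ∈ 𝓝[>] (0 : ℝ))).exists
      have h3 : 0 < t := h3
      have h4 := ((hS t h2).sub_const 1).const_mul t⁻¹
      filter_upwards [h4.eventually_lt_const h1, eventually_gt_atTop 0] with n h5 hn
      refine lt_of_le_of_lt ?_ h5
      rw [le_inv_mul_iff₀ h3]
      exact hbound t h2 n hn
  · obtain ⟨t, ht, h2t⟩ : ∃ t : ℝ, 0 < t ∧ 2 * t < δ := ⟨δ / 4, by positivity, by linarith⟩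
    have a1 : |t| < δ := by rw [abs_of_pos ht]; linarith
    have a2 : |2 * t| < δ := by rw [abs_of_pos (by linarith)]; linarith
    have b1 : |-t| < δ := by rwa [abs_neg]
    have b2 : |2 * -t| < δ := by rwa [mul_neg, abs_neg]
    set e : ℕ → ℝ := fun n => (Real.sqrt n)⁻¹ with he
    have he0 : Tendsto e atTop (𝓝 0) :=
      (Real.tendsto_sqrt_atTop.comp tendsto_natCast_atTop_atTop).inv_tendsto_atTop
    have hlim : Tendsto (fun n : ℕ => (t ^ 2)⁻¹ *
        ((e n / 2 + e n * (S (2 * t) n / n + S (2 * -t) n / n)) * (S t n / n + S (-t) n / n)))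
        atTop (𝓝 0) := by
      have := (((he0.div_const 2).add (he0.mul ((hS _ a2).add (hS _ b2)))).mul
        ((hS _ a1).add (hS _ b1))).const_mul (t ^ 2)⁻¹
      simpa using this
    refine squeeze_zero' (Eventually.of_forall fun n => by positivity) ?_ hlim
    filter_upwards [eventually_gt_atTop 0] with n hn
    have hn' : (0 : ℝ) < n := by exact_mod_cast hn
    have hs : 0 < Real.sqrt n := Real.sqrt_pos.2 hn'
    have hen : 0 < e n := inv_pos.2 hs
    have hee : e n * e n * n = 1 := by
      have := Real.mul_self_sqrt hn'.le
      rw [he]; field_simp; rw [sq, this]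
    set r : Fin n → ℝ := fun i => q n i (H + t) + q n i (H + -t) with hr
    set R2 := S (2 * t) n + S (2 * -t) n with hR2
    have hlam : ∀ i, |lam n i| ≤ t⁻¹ * r i := by
      intro i
      rw [le_inv_mul_iff₀ ht]
      have h1 := htan n i t a1
      have h2 := htan n i (-t) b1
      have h3 := hq0 n i t a1
      have h4 := hq0 n i (-t) b1
      rw [← abs_of_pos ht, ← abs_mul]
      refine abs_le.2 ⟨?_, ?_⟩ <;> simp only [hr] <;> linarith
    have hr0 : ∀ i, 0 ≤ r i := fun i => add_nonneg (hq0 n i t a1) (hq0 n i (-t) b1)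
    have hle : ∀ u, |u| < δ → ∀ i, q n i (H + u) ≤ S u n := fun u hu i =>
      (Finset.single_le_sum (f := fun i => q n i (H + u)) (fun j _ => hq0 n j u hu)
        (Finset.mem_univ i)).trans (hsum n u hu)
    have hrmax : ∀ i, r i ≤ 1 / (2 * e n) + e n * R2 := by
      intro i
      have h1 := hinterp n i t (e n) hen a2
      have h2 := hinterp n i (-t) (e n) hen b2
      have h3 := mul_le_mul_of_nonneg_left (hle _ a2 i) hen.le
      have h4 := mul_le_mul_of_nonneg_left (hle _ b2 i) hen.le
      have h5 : 1 / (2 * e n) = 1 / (4 * e n) + 1 / (4 * e n) := by field_simp; norm_num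
      simp only [hr, hR2, h5, mul_add]
      linarith
    have hrsum : ∑ i, r i ≤ S t n + S (-t) n := by
      rw [Finset.sum_add_distrib]
      exact add_le_add (hsum n t a1) (hsum n (-t) b1)
    have hmax0 : 0 ≤ 1 / (2 * e n) + e n * R2 := (hr0 ⟨0, hn⟩).trans (hrmax _)
    have hfin : ∑ i, lam n i ^ 2 ≤
        (t ^ 2)⁻¹ * ((1 / (2 * e n) + e n * R2) * (S t n + S (-t) n)) := by
      calc ∑ i, lam n i ^ 2 ≤ ∑ i, (t ^ 2)⁻¹ * ((1 / (2 * e n) + e n * R2) * r i) := by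
            refine Finset.sum_le_sum fun i _ => ?_
            rw [← sq_abs]
            calc |lam n i| ^ 2 ≤ (t⁻¹ * r i) ^ 2 :=
                  pow_le_pow_left₀ (abs_nonneg _) (hlam i) 2
              _ = (t ^ 2)⁻¹ * (r i * r i) := by rw [mul_pow, inv_pow, sq (r i)]
              _ ≤ _ := by gcongr; exacts [hr0 i, hrmax i]
        _ = (t ^ 2)⁻¹ * ((1 / (2 * e n) + e n * R2) * ∑ i, r i) := by
            rw [← Finset.mul_sum, ← Finset.mul_sum]
        _ ≤ _ := by gcongr
    rw [div_le_iff₀ (by positivity)]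
    refine hfin.trans_eq ?_
    have h6 : 1 / (2 * e n) = e n / 2 * n := by
      rw [div_eq_iff (by positivity)]
      linear_combination -hee
    rw [h6]
    simp only [hR2]
    field_simp

lemma qForm_smul {n : ℕ} (r : ℝ) (M : Matrix (Fin n) (Fin n) ℝ) (x : Fin n → ℝ) :
    qForm (r • M) x = r * qForm M x := by
  simp only [qForm, Matrix.smul_apply, smul_eq_mul, Finset.mul_sum]
  exact Finset.sum_congr rfl fun i _ => Finset.sum_congr rfl fun j _ => by ring

lemma qForm_smul_vec {n : ℕ} (r : ℝ) (M : Matrix (Fin n) (Fin n) ℝ) (x : Fin n → ℝ) :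
    qForm M (fun i => r * x i) = r ^ 2 * qForm M x := by
  simp only [qForm, Finset.mul_sum]
  exact Finset.sum_congr rfl fun i _ => Finset.sum_congr rfl fun j _ => by ring

lemma qForm_neg {n : ℕ} (M : Matrix (Fin n) (Fin n) ℝ) (x : Fin n → ℝ) :
    qForm (-M) x = -qForm M x := by
  rw [← neg_one_smul ℝ, qForm_smul, neg_one_mul]

lemma qForm_col {n m : ℕ} (M : Matrix (Fin n) (Fin n) ℝ) (B : Matrix (Fin n) (Fin m) ℝ)
    (k : Fin m) : qForm M (fun i => B i k) = (Bᵀ * M * B) k k := by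
  simp only [qForm, Matrix.mul_apply, Matrix.transpose_apply, Finset.sum_mul]
  exact Finset.sum_comm

lemma hasDerivAt_matrix_inv_apply {n : ℕ} {A : ℝ → Matrix (Fin n) (Fin n) ℝ}
    {A' : Matrix (Fin n) (Fin n) ℝ} {t : ℝ} (hA : ∀ i j, HasDerivAt (fun s => A s i j) (A' i j) t)
    (hdet : (A t).det ≠ 0) (i j : Fin n) :
    HasDerivAt (fun s => (A s)⁻¹ i j) (-((A t)⁻¹ * A' * (A t)⁻¹) i j) t := by
  have hcont : Tendsto A (𝓝 t) (𝓝 (A t)) :=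
    tendsto_pi_nhds.2 fun i => tendsto_pi_nhds.2 fun j => (hA i j).continuousAt
  have hslope : Tendsto (fun s => (s - t)⁻¹ • (A s - A t)) (𝓝[≠] t) (𝓝 A') := by
    refine tendsto_pi_nhds.2 fun i => tendsto_pi_nhds.2 fun j => ?_
    have := hasDerivAt_iff_tendsto_slope.1 (hA i j)
    exact this
  have hinv : Tendsto (fun s => (A s)⁻¹) (𝓝 t) (𝓝 (A t)⁻¹) := by
    have h : ContinuousAt Ring.inverse (A t).det := by
      rw [Ring.inverse_eq_inv']; exact continuousAt_inv₀ hdet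
    exact (continuousAt_matrix_inv (A t) h).tendsto.comp hcont
  have hev : ∀ᶠ s in 𝓝 t, (A s).det ≠ 0 :=
    (continuous_id.matrix_det.continuousAt.tendsto.comp hcont).eventually_ne hdet
  have hlim := ((hinv.mono_left nhdsWithin_le_nhds).mul hslope).mul
    (tendsto_const_nhds (x := (A t)⁻¹))
  rw [hasDerivAt_iff_tendsto_slope]
  refine (((tendsto_pi_nhds.1 (tendsto_pi_nhds.1 hlim i)) j).neg).congr' ?_
  filter_upwards [hev.filter_mono nhdsWithin_le_nhds] with s hs
  have h1 : (A s)⁻¹ * A s = 1 := nonsing_inv_mul _ (isUnit_iff_ne_zero.2 hs)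
  have h2 : A t * (A t)⁻¹ = 1 := mul_nonsing_inv _ (isUnit_iff_ne_zero.2 hdet)
  rw [mul_smul_comm, smul_mul_assoc, mul_sub, sub_mul, h1, one_mul, mul_assoc, h2, mul_one,
    slope_def_field, Matrix.smul_apply, Matrix.sub_apply, smul_eq_mul, div_eq_inv_mul]
  ring

lemma differentiableAt_abs_rpow_two_mul (c : ℝ) {h : ℝ} (hh : 0 < h) :
    DifferentiableAt ℝ (fun y : ℝ => |c| ^ (2 * y)) h := by
  rcases eq_or_ne c 0 with rfl | hc
  · refine (differentiableAt_const (0 : ℝ)).congr_of_eventuallyEq ?_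
    filter_upwards [lt_mem_nhds hh] with y hy
    rw [abs_zero, Real.zero_rpow (by positivity)]
  · have h1 : HasDerivAt (fun y : ℝ => 2 * y) 2 h := by
      simpa using (hasDerivAt_id h).const_mul (2 : ℝ)
    exact (h1.const_rpow (abs_pos.2 hc)).differentiableAt

lemma hasDerivAt_fgnT {h : ℝ} (hh : 0 < h) (n : ℕ) (i j : Fin n) :
    HasDerivAt (fun y => fgnT n y i j) (dT n h i j) h := by
  refine DifferentiableAt.hasDerivAt ?_
  unfold fgnT
  exact (((differentiableAt_abs_rpow_two_mul _ hh).sub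
    ((differentiableAt_abs_rpow_two_mul _ hh).const_mul 2)).add
    (differentiableAt_abs_rpow_two_mul _ hh)).div_const 2

lemma fgnT_symm (n : ℕ) (h : ℝ) (i j : Fin n) : fgnT n h i j = fgnT n h j i := by
  unfold fgnT
  rw [abs_sub_comm ((i : ℕ) : ℝ), ← abs_neg (((i : ℕ) : ℝ) - ((j : ℕ) : ℝ) + 1),
    ← abs_neg (((i : ℕ) : ℝ) - ((j : ℕ) : ℝ) - 1),
    show -(((i : ℕ) : ℝ) - ((j : ℕ) : ℝ) + 1) = ((j : ℕ) : ℝ) - ((i : ℕ) : ℝ) - 1 by ring,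
    show -(((i : ℕ) : ℝ) - ((j : ℕ) : ℝ) - 1) = ((j : ℕ) : ℝ) - ((i : ℕ) : ℝ) + 1 by ring]
  ring

lemma dT_isHermitian (n : ℕ) (h : ℝ) : (dT n h).IsHermitian := by
  ext i j
  simp only [conjTranspose_apply, star_trivial, dT, fgnT_symm n _ i j]

lemma fgnT_posDef {h : ℝ} (hh : 0 < h) (hh1 : h < 1) (n : ℕ) : (fgnT n h).PosDef := by
  rw [fgnT_eq_toep hh hh1]
  exact (toep_posDef (integrable_specF hh hh1) (ae_specF_pos hh) n).smul (specC_pos hh hh1)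

lemma dInvT_eq {h : ℝ} (hh : 0 < h) (hh1 : h < 1) (n : ℕ) :
    dInvT n h = -((fgnT n h)⁻¹ * dT n h * (fgnT n h)⁻¹) := by
  ext i j
  exact (hasDerivAt_matrix_inv_apply (hasDerivAt_fgnT hh n)
    (fgnT_posDef hh hh1 n).det_pos.ne' i j).deriv

lemma qForm_fgnT {h : ℝ} (hh : 0 < h) (hh1 : h < 1) {n : ℕ} (x : Fin n → ℝ) :
    qForm (fgnT n h) x = specC h * qForm (toep (specF h) n) x := by
  rw [fgnT_eq_toep hh hh1, qForm_smul]

lemma hasDerivAt_qForm_toep {h : ℝ} (hh : 0 < h) (hh1 : h < 1) {n : ℕ} (x : Fin n → ℝ) :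
    HasDerivAt (fun y => specC h * qForm (toep (specF y) n) x)
      (qForm (dT n h) x - deriv specC h / specC h * qForm (fgnT n h) x) h := by
  have hC := specC_pos hh hh1
  have h1 : HasDerivAt (fun y => qForm (fgnT n y) x) (qForm (dT n h) x) h := by
    unfold qForm
    exact HasDerivAt.fun_sum fun i _ => HasDerivAt.fun_sum fun j _ =>
      ((hasDerivAt_fgnT hh n i j).const_mul (x i)).mul_const (x j)
  have h2 := (h1.div (differentiableAt_specC hh).hasDerivAt hC.ne').const_mul (specC h)
  have h3 : (fun y => specC h * qForm (toep (specF y) n) x) =ᶠ[𝓝 h]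
      fun y => specC h * ((fun y => qForm (fgnT n y) x) / specC) y := by
    filter_upwards [Ioo_mem_nhds hh hh1] with y hy
    have := specC_pos hy.1 hy.2
    rw [Pi.div_apply, qForm_fgnT hy.1 hy.2, mul_div_cancel_left₀ _ this.ne']
  refine (h2.congr_of_eventuallyEq h3).congr_deriv ?_
  field_simp

lemma convexOn_qForm_toep {n : ℕ} (x : Fin n → ℝ) :
    ConvexOn ℝ (Set.Ioo 0 1) fun h => qForm (toep (specF h) n) x := by
  refine ⟨convex_Ioo 0 1, fun h₁ hh₁ h₂ hh₂ a b ha hb hab => ?_⟩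
  have hh := convex_Ioo (0 : ℝ) 1 hh₁ hh₂ ha hb hab
  simp only [smul_eq_mul] at hh ⊢
  have hi₁ := integrable_specF hh₁.1 hh₁.2
  have hi₂ := integrable_specF hh₂.1 hh₂.2
  have hj₁ := (integrable_mul_trigSq hi₁ x).const_mul a
  have hj₂ := (integrable_mul_trigSq hi₂ x).const_mul b
  rw [qForm_toep (integrable_specF hh.1 hh.2), qForm_toep hi₁, qForm_toep hi₂,
    ← integral_const_mul, ← integral_const_mul, ← integral_add hj₁ hj₂]
  refine integral_mono_ae (integrable_mul_trigSq (integrable_specF hh.1 hh.2) x) (hj₁.add hj₂) ?_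
  filter_upwards [ae_circ_ne_zero] with l hl
  have h1 := specF_convex_combination_le ha hb hab hh₁.1 hh₂.1
    (abs_le.2 ⟨hl.1.1.le, hl.1.2⟩) hl.2
  have h2 := mul_le_mul_of_nonneg_right h1 (trigSq_nonneg x l)
  linarith

lemma qForm_toep_add_le {h t ε : ℝ} {n : ℕ} (x : Fin n → ℝ) (hε : 0 < ε)
    (hh : h ∈ Set.Ioo (0 : ℝ) 1) (hh₂ : h + 2 * t ∈ Set.Ioo (0 : ℝ) 1) :
    qForm (toep (specF (h + t)) n) x ≤
      1 / (4 * ε) * qForm (toep (specF h) n) x + ε * qForm (toep (specF (h + 2 * t)) n) x := by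
  have hm : h + t ∈ Set.Ioo (0 : ℝ) 1 := ⟨by linarith [hh.1, hh₂.1], by linarith [hh.2, hh₂.2]⟩
  have hi := integrable_specF hh.1 hh.2
  have hi₂ := integrable_specF hh₂.1 hh₂.2
  have hj := (integrable_mul_trigSq hi x).const_mul (1 / (4 * ε))
  have hj₂ := (integrable_mul_trigSq hi₂ x).const_mul ε
  rw [qForm_toep (integrable_specF hm.1 hm.2), qForm_toep hi, qForm_toep hi₂,
    ← integral_const_mul, ← integral_const_mul, ← integral_add hj hj₂]
  refine integral_mono_ae (integrable_mul_trigSq (integrable_specF hm.1 hm.2) x) (hj.add hj₂) ?_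
  filter_upwards [ae_circ_ne_zero] with l hl
  have h1 := specF_add_le hε hh.1 hh₂.1 (abs_le.2 ⟨hl.1.1.le, hl.1.2⟩) hl.2
  have h2 := mul_le_mul_of_nonneg_right h1 (trigSq_nonneg x l)
  linarith

lemma qForm_toep_specF_nonneg {h : ℝ} (hh : h ∈ Set.Ioo (0 : ℝ) 1) {n : ℕ} (x : Fin n → ℝ) :
    0 ≤ qForm (toep (specF h) n) x := by
  rw [qForm_toep (integrable_specF hh.1 hh.2)]
  exact integral_nonneg fun l => mul_nonneg (specF_nonneg h l) (trigSq_nonneg x l)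

lemma ConvexOn.add_mul_le_of_hasDerivAt {S : Set ℝ} {f : ℝ → ℝ} {f' x t : ℝ} (hf : ConvexOn ℝ S f)
    (hx : x ∈ S) (hxt : x + t ∈ S) (hd : HasDerivAt f f' x) : f x + t * f' ≤ f (x + t) := by
  rcases lt_trichotomy t 0 with ht | rfl | ht
  · have := hf.slope_le_of_hasDerivAt hxt hx (by linarith) hd
    rw [slope_def_field, div_le_iff₀ (by linarith)] at this
    linarith
  · simp
  · have := hf.le_slope_of_hasDerivAt hx hxt (by linarith) hd
    rw [slope_def_field, le_div_iff₀ (by linarith)] at this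
    linarith

/-- The generalised eigenvalues of `(T_n(H), ∂_H T_n(H))` have convergent means, and their
squares are negligible at scale `n²`. -/
lemma exists_eigenvalues_dT {H : ℝ} (hH : 0 < H) (hH1 : H < 1) :
    ∃ (B : ∀ n : ℕ, Matrix (Fin n) (Fin n) ℝ) (d : ∀ n : ℕ, Fin n → ℝ),
      (∀ n, (B n)ᵀ * fgnT n H * B n = 1) ∧ (∀ n, (B n)ᵀ * dT n H * B n = diagonal (d n)) ∧
      Tendsto (fun n : ℕ => (∑ i, d n i) / n) atTop (𝓝 (-jH H)) ∧
      Tendsto (fun n : ℕ => (∑ i, d n i ^ 2) / (n : ℝ) ^ 2) atTop (𝓝 0) := by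
  choose B d hB hd using fun n =>
    exists_simultaneous_diagonalization (fgnT_posDef hH hH1 n) (dT_isHermitian n H)
  refine ⟨B, d, hB, hd, ?_⟩
  have hC := specC_pos hH hH1
  set γ := deriv specC H / specC H with hγ
  obtain ⟨δ, hδ, hball, hcase⟩ : ∃ δ : ℝ, 0 < δ ∧ (∀ t, |t| < δ → H + t ∈ Set.Ioo (0 : ℝ) 1) ∧
      ∀ t, |t| < δ → H < 1 / 2 → H + t < 1 / 2 := by
    obtain ⟨δ₁, h1, h2⟩ := Metric.mem_nhds_iff.1 (Ioo_mem_nhds hH hH1)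
    have hmem : ∀ t, |t| < δ₁ → H + t ∈ Set.Ioo (0 : ℝ) 1 := fun t ht =>
      h2 (by rw [Metric.mem_ball, Real.dist_eq]; simpa using ht)
    by_cases hc : H < 1 / 2
    · refine ⟨min δ₁ (1 / 2 - H), lt_min h1 (by linarith), fun t ht =>
        hmem t (ht.trans_le (min_le_left _ _)), fun t ht _ => ?_⟩
      have := (le_abs_self t).trans_lt (ht.trans_le (min_le_right _ _))
      linarith
    · exact ⟨δ₁, h1, hmem, fun t _ h => absurd h hc⟩
  have hqT : ∀ n i, specC H * qForm (toep (specF H) n) (fun j => B n j i) = 1 := fun n i => by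
    rw [← qForm_fgnT hH hH1, qForm_col, hB, Matrix.one_apply_eq]
  have hqd : ∀ n i, qForm (dT n H) (fun j => B n j i) = d n i := fun n i => by
    rw [qForm_col, hd, diagonal_apply_eq]
  have hder := (hasDerivAt_traceLim hH).2
  have key := tendsto_mean_and_sum_sq_of_convex_bounds (G := traceLim H)
    (lam := fun n i => d n i - γ)
    (q := fun n i h => specC H * qForm (toep (specF h) n) (fun j => B n j i))
    (S := fun t n => 1 / (4 * Real.pi ^ 2) *
      toepPair (fun l => (specF H l)⁻¹) (specF (H + t)) n)
    hδ hder.differentiableAt.hasDerivAt (traceLim_self hH) ?_ ?_ ?_ ?_ ?_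
  · have hjH := jH_eq hH hH1
    constructor
    · have := key.1.add_const γ
      rw [show -jH H = deriv (traceLim H) H + γ by rw [hjH]; ring]
      refine this.congr' ?_
      filter_upwards [eventually_gt_atTop 0] with n hn
      have hn' : (n : ℝ) ≠ 0 := by positivity
      rw [Finset.sum_sub_distrib, Finset.sum_const, Finset.card_univ, Fintype.card_fin,
        nsmul_eq_mul]
      field_simp
      ring
    · have hlim : Tendsto (fun n : ℕ => 2 * ((∑ i, (d n i - γ) ^ 2) / (n : ℝ) ^ 2) +
          2 * γ ^ 2 * (n : ℝ)⁻¹) atTop (𝓝 0) := by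
        simpa using (key.2.const_mul 2).add
          (tendsto_natCast_atTop_atTop.inv_tendsto_atTop.const_mul (2 * γ ^ 2))
      refine squeeze_zero' (Eventually.of_forall fun n => by positivity) ?_ hlim
      filter_upwards [eventually_gt_atTop 0] with n hn
      have hn' : (0 : ℝ) < n := by exact_mod_cast hn
      have h1 : ∑ i, d n i ^ 2 ≤ ∑ i, (2 * (d n i - γ) ^ 2 + 2 * γ ^ 2) :=
        Finset.sum_le_sum fun i _ => by nlinarith [sq_nonneg (d n i - 2 * γ)]
      rw [Finset.sum_add_distrib, ← Finset.mul_sum, Finset.sum_const, Finset.card_univ,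
        Fintype.card_fin, nsmul_eq_mul] at h1
      rw [div_le_iff₀ (by positivity)]
      refine h1.trans_eq ?_
      field_simp
  · exact fun n i t ht => mul_nonneg hC.le (qForm_toep_specF_nonneg (hball t ht) _)
  · intro n i t ht
    have hconv := (convexOn_qForm_toep (fun j => B n j i)).smul hC.le
    have := ConvexOn.add_mul_le_of_hasDerivAt hconv ⟨hH, hH1⟩ (hball t ht)
      (hasDerivAt_qForm_toep hH hH1 _)
    simp only [smul_eq_mul] at this
    rwa [hqT, hqd, qForm_col, hB, Matrix.one_apply_eq, mul_one] at this
  · intro n i t ε hε ht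
    have := mul_le_mul_of_nonneg_left
      (qForm_toep_add_le (fun j => B n j i) hε ⟨hH, hH1⟩ (hball _ ht)) hC.le
    refine this.trans_eq ?_
    linear_combination 1 / (4 * ε) * hqT n i
  · intro n t ht
    have hB' : (Real.sqrt (specC H) • B n)ᵀ * toep (specF H) n * (Real.sqrt (specC H) • B n) =
        1 := by
      rw [← hB n, fgnT_eq_toep hH hH1, transpose_smul, smul_mul_assoc, smul_mul_assoc,
        mul_smul_comm, smul_smul, Real.mul_self_sqrt hC.le, mul_smul_comm, smul_mul_assoc]
    have h1 := sum_qForm_col_le (integrable_specF hH hH1) (ae_specF_pos hH)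
      (integrable_specF_inv hH) (integrable_specF (hball t ht).1 (hball t ht).2)
      (ae_of_all _ fun l => specF_nonneg _ l) hB'
    refine le_trans (le_of_eq ?_) h1
    refine Finset.sum_congr rfl fun i _ => ?_
    simp only [Matrix.smul_apply, smul_eq_mul]
    rw [qForm_smul_vec, Real.sq_sqrt hC.le]
  · intro t ht
    have h0 := pairLim_specF hH (hball t ht).1 (hball t ht).2 (hcase t ht)
    have h1 := Tendsto.const_mul (1 / (4 * Real.pi ^ 2)) h0
    have hpi := Real.pi_pos
    convert h1 using 2
    · ring
    · rw [traceLim]; field_simp; ring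

/-- **Law of large numbers for the first-derivative quadratic form.** Under `P^n_{(H,σ)}`,
`D_n → j_H = -(1/(2π)) ∫_{-π}^{π} ∂_H log f_H(λ) dλ` in probability. -/
theorem Dstat_tendsto_inProb (H σ : ℝ) (hH : H ∈ Set.Ioo (0 : ℝ) 1) (hσ : 0 < σ)
    (Δ : ℕ → ℝ) (hΔ : ∀ n, 0 < Δ n) :
    TendstoInProb (fun n => fgnP n (Δ n) H σ) (fun n => Dstat n (Δ n) H σ) (jH H) := by
  obtain ⟨B, d, hB, hd, hmean, hsq⟩ := exists_eigenvalues_dT hH.1 hH.2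
  intro ε hε
  have hε2 : 0 < ε / 2 := by positivity
  have hlim : Tendsto (fun n : ℕ => ENNReal.ofReal
      (ProbabilityTheory.variance (fun x : ℝ => x ^ 2) (ProbabilityTheory.gaussianReal 0 1) *
        (∑ i, d n i ^ 2) / ((n : ℝ) * (ε / 2)) ^ 2)) atTop (𝓝 0) := by
    have h1 := ENNReal.tendsto_ofReal (hsq.const_mul
      (ProbabilityTheory.variance (fun x : ℝ => x ^ 2) (ProbabilityTheory.gaussianReal 0 1) *
        ((ε / 2) ^ 2)⁻¹))
    rw [mul_zero, ENNReal.ofReal_zero] at h1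
    refine h1.congr fun n => ?_
    congr 1
    ring
  refine tendsto_of_tendsto_of_tendsto_of_le_of_le' tendsto_const_nhds hlim
    (Eventually.of_forall fun _ => zero_le) ?_
  filter_upwards [eventually_gt_atTop 0, hmean.eventually (Metric.ball_mem_nhds _ hε2)] with n hn hm
  rw [Real.dist_eq] at hm
  have hc : 0 < σ ^ 2 * Δ n ^ (2 * H) :=
    mul_pos (pow_pos hσ 2) (Real.rpow_pos_of_pos (hΔ n) _)
  refine (measure_mono fun x hx => ?_).trans (gaussianPi_qForm_concentration
    (fgnT_posDef hH.1 hH.2 n) (hB n) (hd n) hc hn hε2)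
  rw [Set.mem_ofPred_eq] at hx ⊢
  rw [Dstat, dInvT_eq hH.1 hH.2, qForm_neg, mul_assoc (n : ℝ), neg_div] at hx
  set y := qForm ((fgnT n H)⁻¹ * dT n H * (fgnT n H)⁻¹) x / (n * (σ ^ 2 * Δ n ^ (2 * H)))
  have h1 : |-y - jH H| ≤ |y - (∑ i, d n i) / n| + |(∑ i, d n i) / n - -jH H| := by
    rw [← abs_neg, show -(-y - jH H) = (y - (∑ i, d n i) / n) + ((∑ i, d n i) / n - -jH H) by ring]
    exact abs_add_le _ _
  linarith
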